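/- arXiv:1803.09362 — 7 statements merged into one kernel-verified Lean document; each statement's English description precedes it below -/
import Mathlib

section
/- Suppose the N×N real matrix L satisfies the Laplacian decomposition hypotheses with data (ω, U, V, D). Then for every t ∈ ℝ the matrix exponential satisfies exp(L t) = U exp(D t) V^T + 1 ω^T, where 1 = (1,...,1)^T ∈ ℝ^N. -/
open Matrix Filter
open scoped Matrix

noncomputable section

/-- Laplacian decomposition hypotheses for an `N × N` real matrix `L` (`N ≥ 2`), with data
`(ω, U, V, D)`: `ω ∈ ℝ^N` has positive entries summing to `1`; `U, V ∈ ℂ^{N×(N-1)}`;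
`D ∈ ℂ^{(N-1)×(N-1)}` is upper triangular with all diagonal entries of positive real part;
and, viewing `L` as a complex matrix, `L = U D Vᵀ`, `Vᵀ U = I`, `Vᵀ 1 = 0`, `ωᵀ U = 0`,
`ωᵀ 1 = 1`, and `U Vᵀ + 1 ωᵀ = I`. -/
structure LapDecomp (N : ℕ) (L : Matrix (Fin N) (Fin N) ℝ) (ω : Fin N → ℝ)
    (U V : Matrix (Fin N) (Fin (N - 1)) ℂ)
    (D : Matrix (Fin (N - 1)) (Fin (N - 1)) ℂ) : Prop where
  two_le : 2 ≤ N
  omega_pos : ∀ i, 0 < ω i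
  omega_sum : ∑ i, ω i = 1
  D_upper : ∀ i j : Fin (N - 1), j < i → D i j = 0
  D_diag_pos : ∀ i, 0 < (D i i).re
  L_eq : L.map Complex.ofReal = U * D * Vᵀ
  VtU : Vᵀ * U = 1
  Vt_one : Vᵀ *ᵥ (fun _ => (1 : ℂ)) = 0
  omega_U : (fun i => (ω i : ℂ)) ᵥ* U = 0
  UVt : U * Vᵀ + Matrix.of (fun _ j => (ω j : ℂ)) = 1

theorem hasSum_exp_matrix {n : ℕ} (A : Matrix (Fin n) (Fin n) ℂ) :
    HasSum (fun k : ℕ => ((k.factorial : ℂ)⁻¹) • A ^ k) (NormedSpace.exp A) := by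
  let _ : NormedRing (Matrix (Fin n) (Fin n) ℂ) := Matrix.linftyOpNormedRing
  let _ : NormedAlgebra ℂ (Matrix (Fin n) (Fin n) ℂ) := Matrix.linftyOpNormedAlgebra
  exact NormedSpace.exp_series_hasSum_exp' (𝕂 := ℂ) A

/-- For `L` satisfying the Laplacian decomposition hypotheses,
`exp (L t) = U exp (D t) Vᵀ + 1 ωᵀ` for every `t ∈ ℝ`. -/
theorem exp_laplacian_eq {N : ℕ} {L : Matrix (Fin N) (Fin N) ℝ} {ω : Fin N → ℝ}
    {U V : Matrix (Fin N) (Fin (N - 1)) ℂ} {D : Matrix (Fin (N - 1)) (Fin (N - 1)) ℂ}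
    (h : LapDecomp N L ω U V D) (t : ℝ) :
    NormedSpace.exp (t • L.map Complex.ofReal) =
      U * NormedSpace.exp (t • D) * Vᵀ + Matrix.of (fun _ j => (ω j : ℂ)) := by
  set W : Matrix (Fin N) (Fin N) ℂ := Matrix.of (fun _ j => (ω j : ℂ)) with hW
  have hL : t • L.map Complex.ofReal = U * (t • D) * Vᵀ := by
    rw [h.L_eq, Matrix.mul_smul, Matrix.smul_mul]
  have hpow : ∀ k : ℕ, (t • L.map Complex.ofReal) ^ (k + 1) = U * (t • D) ^ (k + 1) * Vᵀ := by
    intro k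
    induction k with
    | zero => simpa using hL
    | succ k ih =>
      rw [pow_succ, ih, hL, pow_succ (t • D) (k + 1)]
      calc U * (t • D) ^ (k + 1) * Vᵀ * (U * (t • D) * Vᵀ)
          = U * (t • D) ^ (k + 1) * (Vᵀ * U) * (t • D) * Vᵀ := by
            simp only [Matrix.mul_assoc]
        _ = _ := by rw [h.VtU, Matrix.mul_one]; simp only [Matrix.mul_assoc]
  have h1 := hasSum_exp_matrix (t • L.map Complex.ofReal)
  have h2 := hasSum_exp_matrix (t • D)
  let φ : Matrix (Fin (N - 1)) (Fin (N - 1)) ℂ →+ Matrix (Fin N) (Fin N) ℂ :=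
    { toFun := fun X => U * X * Vᵀ
      map_zero' := by simp
      map_add' := fun X Y => by rw [Matrix.mul_add, Matrix.add_mul] }
  have hφ : Continuous φ := by
    change Continuous (fun X : Matrix (Fin (N - 1)) (Fin (N - 1)) ℂ => U * X * Vᵀ)
    fun_prop
  have h3 := (h2.map φ hφ).add (hasSum_ite_eq (0 : ℕ) W)
  have hfun : (fun k : ℕ => ((k.factorial : ℂ)⁻¹) • (t • L.map Complex.ofReal) ^ k) =
      fun k : ℕ => (φ ∘ fun k : ℕ => ((k.factorial : ℂ)⁻¹) • (t • D) ^ k) k +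
        (if k = 0 then W else 0) := by
    funext k
    change _ = U * (((k.factorial : ℂ)⁻¹) • (t • D) ^ k) * Vᵀ + _
    cases k with
    | zero => simpa using h.UVt.symm
    | succ k => rw [hpow k, Matrix.mul_smul, Matrix.smul_mul, if_neg (Nat.succ_ne_zero k), add_zero]
  rw [hfun] at h1
  exact h1.unique h3
end
end

section
/- Suppose the N×N real matrix L satisfies the Laplacian decomposition hypotheses with data (ω, U, V, D), let ρ > 0 and x̄ ∈ ℝ^N. Then for every t ≥ 0 the vector g(t) := ∫₀ᵗ exp(−ρ L (t−s)) L x̄ ds equals (1/ρ) U (I_{N−1} − exp(−ρ D t)) V^T x̄, and consequently lim_{t→∞} g(t) = (1/ρ) U V^T x̄. -/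
open Matrix Filter
open scoped Matrix

noncomputable section

section helpers
open scoped Matrix.Norms.Operator

lemma aux_intertwine {m n : ℕ} (M : Matrix (Fin m) (Fin m) ℂ) (D : Matrix (Fin n) (Fin n) ℂ)
    (U : Matrix (Fin m) (Fin n) ℂ) (h : M * U = U * D) :
    NormedSpace.exp M * U = U * NormedSpace.exp D := by
  have h1 := (NormedSpace.exp_series_hasSum_exp' (𝕂 := ℂ) M)
  have h2 := (NormedSpace.exp_series_hasSum_exp' (𝕂 := ℂ) D)
  have h3 := h1.map (AddMonoidHom.mk' (fun X : Matrix (Fin m) (Fin m) ℂ => X * U)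
    (fun X Y => Matrix.add_mul X Y U)) (by
      show Continuous (fun X : Matrix (Fin m) (Fin m) ℂ => X * U); fun_prop)
  have h4 := h2.map (AddMonoidHom.mk' (fun X : Matrix (Fin n) (Fin n) ℂ => U * X)
    (fun X Y => Matrix.mul_add U X Y)) (by
      show Continuous (fun X : Matrix (Fin n) (Fin n) ℂ => U * X); fun_prop)
  have hp : ∀ k : ℕ, M ^ k * U = U * D ^ k := by
    intro k
    induction k with
    | zero => simp
    | succ k ih => rw [pow_succ, Matrix.mul_assoc, h, ← Matrix.mul_assoc, ih, Matrix.mul_assoc, ← pow_succ]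
  refine h3.unique ?_
  refine Eq.subst (motive := fun F => HasSum F (U * NormedSpace.exp D)) ?_ h4
  funext k
  simp [hp]

lemma aux_deriv {n : ℕ} (D : Matrix (Fin n) (Fin n) ℂ) (t : ℝ) :
    HasDerivAt (fun u : ℝ => NormedSpace.exp (u • D)) (NormedSpace.exp (t • D) * D) t :=
  hasDerivAt_exp_smul_const D t

lemma aux_deriv_entry {n : ℕ} (D : Matrix (Fin n) (Fin n) ℂ) (t : ℝ) (i k : Fin n) :
    HasDerivAt (fun u : ℝ => NormedSpace.exp (u • D) i k) ((D * NormedSpace.exp (t • D)) i k) t := by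
  have h : HasDerivAt (fun u : ℝ => NormedSpace.exp (u • D)) (D * NormedSpace.exp (t • D)) t :=
    hasDerivAt_exp_smul_const' D t
  let P : Matrix (Fin n) (Fin n) ℂ →ₗ[ℝ] ℂ :=
    { toFun := fun X => X i k, map_add' := fun _ _ => rfl, map_smul' := fun _ _ => rfl }
  exact (LinearMap.toContinuousLinearMap P).hasFDerivAt.comp_hasDerivAt t h

lemma aux_formula {m n : ℕ} (M : Matrix (Fin m) (Fin m) ℂ) (D : Matrix (Fin n) (Fin n) ℂ)
    (U V : Matrix (Fin m) (Fin n) ℂ) (hM : M = U * D * Vᵀ) (hVU : Vᵀ * U = 1)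
    {ρ : ℝ} (hρ : 0 < ρ) (x : Fin m → ℂ) (t : ℝ) :
    (∫ s in (0:ℝ)..t, (NormedSpace.exp ((-(ρ * (t - s))) • M) * M) *ᵥ x)
      = (ρ⁻¹ : ℂ) • ((U * (1 - NormedSpace.exp ((-(ρ * t)) • D)) * Vᵀ) *ᵥ x) := by
  have key : ∀ r : ℝ, NormedSpace.exp (r • M) * M = U * (NormedSpace.exp (r • D) * D) * Vᵀ := by
    intro r
    have hi : NormedSpace.exp (r • M) * U = U * NormedSpace.exp (r • D) := by
      apply aux_intertwine
      rw [hM, Matrix.smul_mul, Matrix.mul_smul, Matrix.mul_assoc, hVU, Matrix.mul_one]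
    calc NormedSpace.exp (r • M) * M = NormedSpace.exp (r • M) * (U * D * Vᵀ) := by rw [← hM]
      _ = _ := by rw [← Matrix.mul_assoc, ← Matrix.mul_assoc, hi, Matrix.mul_assoc U]
  let P : Matrix (Fin n) (Fin n) ℂ →ₗ[ℝ] (Fin m → ℂ) :=
    { toFun := fun X => (U * X * Vᵀ) *ᵥ x
      map_add' := fun X Y => by rw [Matrix.mul_add, Matrix.add_mul, Matrix.add_mulVec]
      map_smul' := fun c X => by
        rw [Matrix.mul_smul, Matrix.smul_mul, Matrix.smul_mulVec]; rfl }
  let Q := LinearMap.toContinuousLinearMap P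
  have hQ : ∀ X, Q X = (U * X * Vᵀ) *ᵥ x := fun _ => rfl
  have hd : ∀ s : ℝ, HasDerivAt (fun s : ℝ => ρ⁻¹ • Q (NormedSpace.exp ((-(ρ * (t - s))) • D)))
      (Q (NormedSpace.exp ((-(ρ * (t - s))) • D) * D)) s := by
    intro s
    have h1 : HasDerivAt (fun s : ℝ => -(ρ * (t - s))) ρ s := by
      have := (((hasDerivAt_id s).const_sub t).const_mul ρ).neg
      exact this.congr_deriv (by simp)
    have h2 := (aux_deriv D (-(ρ * (t - s)))).scomp s h1
    have h3 := (Q.hasFDerivAt.comp_hasDerivAt s h2).const_smul ρ⁻¹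
    refine HasDerivAt.congr_deriv h3 ?_
    have h4 : ∀ X, ρ⁻¹ • Q (ρ • X) = Q X := by
      intro X
      rw [map_smul, smul_smul, inv_mul_cancel₀ hρ.ne', one_smul]
    exact h4 _
  have hc : Continuous (fun s : ℝ => Q (NormedSpace.exp ((-(ρ * (t - s))) • D) * D)) := by
    refine Q.continuous.comp (Continuous.mul ?_ continuous_const)
    refine NormedSpace.exp_continuous.comp ?_
    fun_prop
  have hI := intervalIntegral.integral_eq_sub_of_hasDerivAt (a := 0) (b := t)
    (fun s _ => hd s) (hc.intervalIntegrable _ _)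
  have he : (fun s : ℝ => (NormedSpace.exp ((-(ρ * (t - s))) • M) * M) *ᵥ x) =
      fun s : ℝ => Q (NormedSpace.exp ((-(ρ * (t - s))) • D) * D) := by
    funext s
    rw [key, hQ]
  rw [he, hI, ← smul_sub, ← map_sub, ← hQ]
  simp only [sub_self, mul_zero, neg_zero, zero_smul, NormedSpace.exp_zero, sub_zero]
  rw [← Complex.ofReal_inv]
  rfl

lemma aux_scalar {y f : ℝ → ℂ} {d : ℂ} {a C : ℝ} (ha : a < d.re)
    (hy : ∀ t, HasDerivAt y (-d * y t + f t) t)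
    (hf : ∀ t, 0 ≤ t → ‖f t‖ ≤ C * Real.exp (-a * t)) :
    ∃ C' : ℝ, ∀ t, 0 ≤ t → ‖y t‖ ≤ C' * Real.exp (-a * t) := by
  have hC : 0 ≤ C := by
    have := (norm_nonneg _).trans (hf 0 le_rfl)
    simpa using this
  have hpos : 0 < d.re - a := sub_pos.2 ha
  set b := d.re - a with hb
  refine ⟨‖y 0‖ + C / b, fun t ht => ?_⟩
  have hz : ∀ u : ℝ, HasDerivAt (fun u : ℝ => Complex.exp (d * u) * y u)
      (Complex.exp (d * u) * f u) u := by
    intro u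
    have h1 : HasDerivAt (fun u : ℝ => d * (u : ℂ)) d u := by
      simpa using (Complex.ofRealCLM.hasDerivAt (x := u)).const_mul d
    have h2 := h1.cexp.mul (hy u)
    refine HasDerivAt.congr_deriv h2 ?_
    ring
  have hB : ∀ u : ℝ, HasDerivAt (fun u : ℝ => ‖y 0‖ + C / b * Real.exp (b * u))
      (C * Real.exp (b * u)) u := by
    intro u
    have h1 : HasDerivAt (fun u : ℝ => b * u) b u := by
      simpa using (hasDerivAt_id u).const_mul b
    have h2 := (h1.exp.const_mul (C / b)).const_add ‖y 0‖
    refine HasDerivAt.congr_deriv h2 ?_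
    field_simp
  have hn : ∀ u : ℝ, ‖Complex.exp (d * u)‖ = Real.exp (d.re * u) := by
    intro u; rw [Complex.norm_exp]; simp
  have main := image_norm_le_of_norm_deriv_right_le_deriv_boundary (a := 0) (b := t)
    (f := fun u : ℝ => Complex.exp (d * u) * y u)
    (f' := fun u : ℝ => Complex.exp (d * u) * f u)
    (B := fun u : ℝ => ‖y 0‖ + C / b * Real.exp (b * u))
    (B' := fun u => C * Real.exp (b * u))
    (fun u _ => (hz u).continuousAt.continuousWithinAt)
    (fun u _ => (hz u).hasDerivWithinAt)
    (by simp; positivity)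
    hB
    (fun u hu => by
      rw [norm_mul, hn]
      calc _ ≤ Real.exp (d.re * u) * (C * Real.exp (-a * u)) :=
            mul_le_mul_of_nonneg_left (hf u hu.1) (Real.exp_pos _).le
        _ = C * (Real.exp (d.re * u) * Real.exp (-a * u)) := by ring
        _ = _ := by rw [← Real.exp_add]; congr 2; rw [hb]; ring)
    (Set.right_mem_Icc.2 ht)
  rw [norm_mul, hn] at main
  have h1 : (1:ℝ) ≤ Real.exp (b * t) := Real.one_le_exp (by positivity)
  have h2 : Real.exp (d.re * t) * ‖y t‖ ≤ (‖y 0‖ + C / b) * Real.exp (b * t) := by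
    nlinarith [norm_nonneg (y 0)]
  have h3 : Real.exp (b * t) = Real.exp (d.re * t) * Real.exp (-a * t) := by
    rw [← Real.exp_add]; congr 1; rw [hb]; ring
  rw [h3] at h2
  refine le_of_mul_le_mul_left ?_ (Real.exp_pos (d.re * t))
  linarith

lemma aux_decay {n : ℕ} (D : Matrix (Fin n) (Fin n) ℂ)
    (hu : ∀ i j : Fin n, j < i → D i j = 0) (hd : ∀ i, 0 < (D i i).re) :
    Tendsto (fun t : ℝ => NormedSpace.exp ((-t) • D)) atTop (nhds 0) := by
  obtain ⟨a, ha0, ha⟩ : ∃ a : ℝ, 0 < a ∧ ∀ i, a < (D i i).re := by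
    have h := (Filter.eventually_all.2 fun i => (eventually_lt_nhds (hd i)))
    have h' : ∀ᶠ a in nhdsWithin (0:ℝ) (Set.Ioi 0), ∀ i, a < (D i i).re :=
      h.filter_mono nhdsWithin_le_nhds
    obtain ⟨a, h1, h2⟩ := (h'.and self_mem_nhdsWithin).exists
    exact ⟨a, h2, h1⟩
  have key : ∀ m : ℕ, ∀ i : Fin n, n - i.val = m → ∀ k, ∃ C : ℝ, ∀ t, 0 ≤ t →
      ‖NormedSpace.exp ((-t) • D) i k‖ ≤ C * Real.exp (-a * t) := by
    intro m
    induction m using Nat.strong_induction_on with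
    | _ m ih =>
    intro i hi k
    have ih' : ∀ j : Fin n, ∃ C : ℝ, i < j → ∀ t, 0 ≤ t →
        ‖NormedSpace.exp ((-t) • D) j k‖ ≤ C * Real.exp (-a * t) := by
      intro j
      by_cases hj : i < j
      · obtain ⟨C, hC⟩ := ih (n - j.val) (by have := j.2; have : i.val < j.val := hj; omega) j rfl k
        exact ⟨C, fun _ => hC⟩
      · exact ⟨0, fun h => absurd h hj⟩
    choose C hC using ih'
    refine aux_scalar (d := D i i)
      (f := fun t => -∑ j ∈ Finset.univ.erase i, D i j * NormedSpace.exp ((-t) • D) j k)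
      (C := ∑ j ∈ Finset.univ.erase i, ‖D i j‖ * C j) (ha i) ?_ ?_
    · intro t
      have h := (aux_deriv_entry D (-t) i k).scomp t (hasDerivAt_neg t)
      refine HasDerivAt.congr_deriv h ?_
      rw [Matrix.mul_apply, ← Finset.add_sum_erase _ _ (Finset.mem_univ i)]
      simp
      ring
    · intro t ht
      rw [norm_neg, Finset.sum_mul]
      refine norm_sum_le_of_le _ fun j hj => ?_
      rw [norm_mul, mul_assoc]
      rcases lt_or_gt_of_ne (Finset.ne_of_mem_erase hj) with h | h
      · simp [hu i j h]
      · exact mul_le_mul_of_nonneg_left (hC j h t ht) (norm_nonneg _)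
  refine tendsto_pi_nhds.2 fun i => tendsto_pi_nhds.2 fun k => ?_
  obtain ⟨C, hC⟩ := key _ i rfl k
  refine squeeze_zero_norm' (a := fun t => C * Real.exp (-a * t)) ?_ ?_
  · filter_upwards [eventually_ge_atTop 0] with t ht using hC t ht
  · have h1 : Tendsto (fun t : ℝ => -a * t) atTop atBot :=
      tendsto_id.const_mul_atTop_of_neg (by linarith)
    simpa using (Real.tendsto_exp_atBot.comp h1).const_mul C

end helpers

/-- For `L` satisfying the Laplacian decomposition hypotheses, `ρ > 0` and `x̄ ∈ ℝ^N`, the vector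
`g t := ∫₀ᵗ exp(−ρ L (t−s)) L x̄ ds` equals `(1/ρ) U (I − exp(−ρ D t)) Vᵀ x̄` for every `t ≥ 0`,
and `g t → (1/ρ) U Vᵀ x̄` as `t → ∞`. -/
theorem g_formula_and_limit {N : ℕ} {L : Matrix (Fin N) (Fin N) ℝ} {ω : Fin N → ℝ}
    {U V : Matrix (Fin N) (Fin (N - 1)) ℂ} {D : Matrix (Fin (N - 1)) (Fin (N - 1)) ℂ}
    (h : LapDecomp N L ω U V D) {ρ : ℝ} (hρ : 0 < ρ) (xbar : Fin N → ℝ) :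
    (∀ t : ℝ, 0 ≤ t →
      (∫ s in (0:ℝ)..t,
          (NormedSpace.exp ((-(ρ * (t - s))) • L.map Complex.ofReal) *
            L.map Complex.ofReal) *ᵥ (fun i => (xbar i : ℂ)))
        = (ρ⁻¹ : ℂ) •
            ((U * (1 - NormedSpace.exp ((-(ρ * t)) • D)) * Vᵀ) *ᵥ (fun i => (xbar i : ℂ)))) ∧
    Tendsto (fun t : ℝ => ∫ s in (0:ℝ)..t,
          (NormedSpace.exp ((-(ρ * (t - s))) • L.map Complex.ofReal) *
            L.map Complex.ofReal) *ᵥ (fun i => (xbar i : ℂ)))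
      atTop (nhds ((ρ⁻¹ : ℂ) • ((U * Vᵀ) *ᵥ (fun i => (xbar i : ℂ))))) := by
  have hf := fun t : ℝ => aux_formula (L.map Complex.ofReal) D U V h.L_eq h.VtU hρ
    (fun i => (xbar i : ℂ)) t
  refine ⟨fun t _ => hf t, ?_⟩
  simp only [hf]
  have h1 : Tendsto (fun t : ℝ => NormedSpace.exp ((-(ρ * t)) • D)) atTop (nhds 0) :=
    (aux_decay D h.D_upper h.D_diag_pos).comp (tendsto_id.const_mul_atTop hρ)
  have hc : Continuous (fun X : Matrix (Fin (N - 1)) (Fin (N - 1)) ℂ =>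
      (ρ⁻¹ : ℂ) • ((U * (1 - X) * Vᵀ) *ᵥ (fun i => (xbar i : ℂ)))) := by
    fun_prop
  have h2 := (hc.tendsto 0).comp h1
  simpa [Function.comp_def] using h2
end
end

section
/- Suppose the N×N real matrix L satisfies the Laplacian decomposition hypotheses with data (ω, U, V, D) and let ρ > 0. Then exp(−ρ L t) converges to the rank-one matrix 1 ω^T as t → ∞, where 1 = (1,...,1)^T ∈ ℝ^N. -/
open Matrix Filter
open scoped Matrix

noncomputable section

theorem hasSum_matExp {n : Type*} [Fintype n] [DecidableEq n] (A : Matrix n n ℂ) :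
    HasSum (fun k : ℕ => ((k.factorial : ℂ)⁻¹) • A ^ k) (NormedSpace.exp A) := by
  open scoped Matrix.Norms.Operator in
  exact NormedSpace.exp_series_hasSum_exp' (𝕂 := ℂ) A

theorem exp_conj_formula {m n : Type*} [Fintype n] [DecidableEq n] [Fintype m] [DecidableEq m]
    (U V : Matrix m n ℂ) (Q : Matrix m m ℂ) (M : Matrix n n ℂ)
    (h1 : Vᵀ * U = 1) (h2 : U * Vᵀ + Q = 1) :
    NormedSpace.exp (U * M * Vᵀ) = U * NormedSpace.exp M * Vᵀ + Q := by
  have hpow : ∀ k : ℕ, (U * M * Vᵀ) ^ (k+1) = U * M ^ (k+1) * Vᵀ := by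
    intro k
    induction k with
    | zero => simp
    | succ k ih =>
      rw [pow_succ, ih, pow_succ M (k+1)]
      calc _ = U * M ^ (k+1) * (Vᵀ * U) * M * Vᵀ := by simp only [Matrix.mul_assoc]
        _ = _ := by rw [h1]; simp only [Matrix.mul_assoc, Matrix.mul_one, Matrix.one_mul]
  have e1 := hasSum_matExp (U * M * Vᵀ)
  let f : Matrix n n ℂ →+ Matrix m m ℂ :=
    { toFun := fun X => U * X * Vᵀ
      map_zero' := by simp
      map_add' := fun X Y => by rw [Matrix.mul_add, Matrix.add_mul] }
  have hf : Continuous f := by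
    change Continuous (fun X : Matrix n n ℂ => U * X * Vᵀ)
    fun_prop
  have e2 := (hasSum_matExp M).map f hf
  have e3 := e2.add (hasSum_ite_eq (0 : ℕ) Q)
  refine e1.unique ?_
  have e4 : (fun k : ℕ => ((k.factorial : ℂ)⁻¹) • (U * M * Vᵀ) ^ k) = fun b : ℕ =>
      (f ∘ fun k : ℕ => ((k.factorial : ℂ)⁻¹) • M ^ k) b + if b = 0 then Q else 0 := ?_
  · rw [e4]; exact e3
  funext k
  cases k with
  | zero => simp [f, h2]
  | succ k => simp [f, hpow]

theorem exp_genEig {n : Type*} [Fintype n] [DecidableEq n]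
    (A : Matrix n n ℂ) (a : ℂ) (k : ℕ) (x : n → ℂ) (hx : (A - a • 1) ^ k *ᵥ x = 0) (s : ℝ) :
    NormedSpace.exp ((-s) • A) *ᵥ x =
      ∑ j ∈ Finset.range k, (Complex.exp (-s * a) * ((j.factorial : ℂ)⁻¹ * (-s : ℂ) ^ j)) •
        ((A - a • 1) ^ j *ᵥ x) := by
  have hs : (-s) • A = (diagonal (fun _ => -s * a)) + (-s : ℂ) • (A - a • 1) := by
    ext i j
    by_cases hij : i = j
    · subst hij
      simp
      ring
    · simp [hij]
  have hc : Commute (diagonal (fun _ : n => -s * a)) ((-s : ℂ) • (A - a • 1)) := by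
    change _ = _
    ext i j
    simp [mul_comm]
  rw [hs, Matrix.exp_add_of_commute _ _ hc, Matrix.exp_diagonal]
  have hd : (diagonal (NormedSpace.exp (fun _ : n => -s * a)) : Matrix n n ℂ)
      = Complex.exp (-s * a) • 1 := by
    rw [Matrix.smul_one_eq_diagonal]
    congr 1
    ext i
    rw [Pi.coe_exp, Complex.exp_eq_exp_ℂ]
  rw [hd, Matrix.smul_mul, Matrix.one_mul, Matrix.smul_mulVec]
  let f : Matrix n n ℂ →+ (n → ℂ) :=
    { toFun := fun X => X *ᵥ x
      map_zero' := by simp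
      map_add' := fun X Y => by rw [Matrix.add_mulVec] }
  have hf : Continuous f := by
    change Continuous (fun X : Matrix n n ℂ => X *ᵥ x)
    fun_prop
  have e2 := (hasSum_matExp ((-s : ℂ) • (A - a • 1))).map f hf
  have e3 : HasSum (f ∘ fun k : ℕ => ((k.factorial : ℂ)⁻¹) • ((-s : ℂ) • (A - a • 1)) ^ k)
      (∑ j ∈ Finset.range k, ((j.factorial : ℂ)⁻¹ * (-s : ℂ) ^ j) • ((A - a • 1) ^ j *ᵥ x)) := by
    convert hasSum_sum_of_ne_finset_zero (s := Finset.range k) ?_ using 1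
    rotate_right
    · infer_instance
    · apply Finset.sum_congr rfl
      intro j _
      simp only [f, Function.comp, AddMonoidHom.coe_mk, ZeroHom.coe_mk, smul_pow, smul_smul,
        Matrix.smul_mulVec]
    · intro j hj
      obtain ⟨l, rfl⟩ := Nat.exists_eq_add_of_le (not_lt.1 (fun h => hj (Finset.mem_range.2 h)))
      simp only [f, Function.comp, AddMonoidHom.coe_mk, ZeroHom.coe_mk, smul_pow, smul_smul,
        Matrix.smul_mulVec]
      rw [add_comm k l, pow_add (A - a • 1), ← Matrix.mulVec_mulVec, hx]
      simp
  have := e2.unique e3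
  change NormedSpace.exp ((-s : ℂ) • (A - a • 1)) *ᵥ x = _ at this
  rw [this, Finset.smul_sum]
  simp only [smul_smul]

theorem scalar_decay (a : ℂ) (ha : 0 < a.re) (j : ℕ) :
    Tendsto (fun s : ℝ => Complex.exp (-s * a) * ((j.factorial : ℂ)⁻¹ * (-s : ℂ) ^ j))
      atTop (nhds 0) := by
  rw [tendsto_zero_iff_norm_tendsto_zero]
  have h := (tendsto_rpow_mul_exp_neg_mul_atTop_nhds_zero j a.re ha).const_mul
    ((j.factorial : ℝ)⁻¹)
  rw [mul_zero] at h
  refine h.congr' ?_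
  filter_upwards [eventually_ge_atTop 0] with s hs
  rw [norm_mul, norm_mul, norm_pow, norm_neg, Complex.norm_exp, norm_inv, Complex.norm_natCast,
    Complex.norm_real, Real.norm_of_nonneg hs, Real.rpow_natCast]
  have : (-(s : ℂ) * a).re = -a.re * s := by simp [mul_comm]
  rw [this]
  ring

theorem exp_tri_decay {n : ℕ} (D : Matrix (Fin n) (Fin n) ℂ)
    (hU : ∀ i j, j < i → D i j = 0) (hD : ∀ i, 0 < (D i i).re) :
    Tendsto (fun s : ℝ => NormedSpace.exp ((-s) • D)) atTop (nhds 0) := by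
  let P : Submodule ℂ (Fin n → ℂ) :=
    { carrier := {x | Tendsto (fun s : ℝ => NormedSpace.exp ((-s) • D) *ᵥ x) atTop (nhds 0)}
      zero_mem' := by simp
      add_mem' := fun {x y} hx hy => by
        simpa [Matrix.mulVec_add] using Tendsto.add hx hy
      smul_mem' := fun c x hx => by
        simpa [Matrix.mulVec_smul] using Tendsto.const_smul hx c }
  have hP : (⊤ : Submodule ℂ (Fin n → ℂ)) ≤ P := by
    rw [← Module.End.iSup_maxGenEigenspace_eq_top (Matrix.toLin' D)]
    refine iSup_le fun a x hx => ?_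
    obtain ⟨k, hk⟩ := Module.End.mem_maxGenEigenspace _ _ _ |>.1 hx
    by_cases hx0 : x = 0
    · rw [hx0]; exact P.zero_mem
    have hmat : (Matrix.toLin' D - a • 1) ^ k = Matrix.toLin' ((D - a • 1) ^ k) := by
      rw [Matrix.toLin'_pow]; simp; rfl
    rw [hmat, Matrix.toLin'_apply] at hk
    have hroot : ∃ i, a = D i i := by
      by_contra! hne
      have hdet : IsUnit ((D - a • 1) ^ k) := by
        apply IsUnit.pow
        rw [Matrix.isUnit_iff_isUnit_det, Matrix.det_of_isUpperTriangular]
        · rw [isUnit_iff_ne_zero, Finset.prod_ne_zero_iff]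
          intro i _
          simpa [sub_eq_zero] using (hne i).symm
        · intro i j hij
          have hij : j < i := hij
          simp [hU i j hij, Matrix.one_apply, hij.ne']
      exact hx0 (Matrix.mulVec_injective_of_isUnit hdet (by simpa using hk))
    obtain ⟨i, rfl⟩ := hroot
    change Tendsto (fun s : ℝ => NormedSpace.exp ((-s) • D) *ᵥ x) atTop (nhds 0)
    simp only [exp_genEig D _ k x hk]
    rw [← Finset.sum_const_zero (s := Finset.range k)]
    refine tendsto_finsetSum _ fun j _ => ?_
    simpa using (scalar_decay _ (hD i) j).smul_const ((D - D i i • 1) ^ j *ᵥ x)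
  refine tendsto_pi_nhds.2 fun i => tendsto_pi_nhds.2 fun j => ?_
  have h1 : Tendsto (fun s : ℝ => NormedSpace.exp ((-s) • D) *ᵥ (Pi.single j 1)) atTop (nhds 0) :=
    @hP (Pi.single j 1) Submodule.mem_top
  simpa using (tendsto_pi_nhds.1 h1 i)

/-- For `L` satisfying the Laplacian decomposition hypotheses and `ρ > 0`,
`exp (−ρ L t) → 1 ωᵀ` as `t → ∞`. -/
theorem exp_neg_laplacian_tendsto {N : ℕ} {L : Matrix (Fin N) (Fin N) ℝ} {ω : Fin N → ℝ}
    {U V : Matrix (Fin N) (Fin (N - 1)) ℂ} {D : Matrix (Fin (N - 1)) (Fin (N - 1)) ℂ}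
    (h : LapDecomp N L ω U V D) {ρ : ℝ} (hρ : 0 < ρ) :
    Tendsto (fun t : ℝ => NormedSpace.exp ((-(ρ * t)) • L.map Complex.ofReal))
      atTop (nhds (Matrix.of (fun _ j => (ω j : ℂ)))) := by
  have hE : ∀ t : ℝ, NormedSpace.exp ((-(ρ * t)) • L.map Complex.ofReal)
      = U * NormedSpace.exp ((-(ρ * t)) • D) * Vᵀ + Matrix.of (fun _ j => (ω j : ℂ)) := by
    intro t
    rw [← exp_conj_formula U V _ _ h.VtU h.UVt, h.L_eq, Matrix.mul_smul, Matrix.smul_mul]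
  have hs : Tendsto (fun t : ℝ => ρ * t) atTop atTop := tendsto_id.const_mul_atTop hρ
  have h0 := (exp_tri_decay D h.D_upper h.D_diag_pos).comp hs
  have hc : Continuous (fun X : Matrix (Fin (N-1)) (Fin (N-1)) ℂ =>
      U * X * Vᵀ + Matrix.of (fun _ j => (ω j : ℂ))) := by fun_prop
  have h2 := (hc.tendsto 0).comp h0
  simp only [hE]
  simpa [Function.comp_def] using h2
end
end

section
/- (Main Lemma, PI consensus error transformation.) Suppose the N×N real matrix L satisfies the Laplacian decomposition hypotheses with data (ω, U, V, D). Let ρ > 0, x̄ ∈ ℝ^N, let x : [0,∞) → ℝ^N be continuous, and define the PI consensus error z(t) := x(t) − x̄ + ρ ∫₀ᵗ L x(s) ds. If z is bounded on [0,∞) and lim_{t→∞} z(t) = 0, then lim_{t→∞} (x_i(t) − x_j(t)) = 0 for all i, j ∈ {1,...,N} and lim_{t→∞} x_i(t) = Σ_{j=1}^N ω_j x̄_j for every i. -/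
open Matrix Filter
open scoped Matrix

noncomputable section

theorem scalar_aux (f g : ℝ → ℂ) (l G : ℂ) (hl : 0 < l.re)
    (hf : ∀ t : ℝ, 0 ≤ t → HasDerivAt f (-l * f t + g t) t)
    (hg : Tendsto g atTop (nhds G)) : Tendsto f atTop (nhds (G / l)) := by
  have hl0 : l ≠ 0 := by rintro rfl; simp at hl
  rw [Metric.tendsto_atTop] at hg ⊢
  intro ε hε
  set a := l.re with ha
  obtain ⟨T0, hT0⟩ := hg (a * ε / 2) (by positivity)
  set T := max T0 0 with hT
  set h : ℝ → ℂ := fun t => Complex.exp (l * t) * (f t - G / l) with hh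
  have hd : ∀ t : ℝ, 0 ≤ t → HasDerivAt h (Complex.exp (l * t) * (g t - G)) t := by
    intro t ht
    have h1 : HasDerivAt (fun t : ℝ => Complex.exp (l * t)) (Complex.exp (l * t) * (l * 1)) t :=
      ((Complex.ofRealCLM.hasDerivAt (x := t)).const_mul l).cexp
    have h2 := h1.mul ((hf t ht).sub_const (G / l))
    refine h2.congr_deriv ?_
    field_simp
    ring
  have hnorm : ∀ t : ℝ, ‖Complex.exp (l * t)‖ = Real.exp (a * t) := by
    intro t; rw [Complex.norm_exp]; simp [ha]
  set B : ℝ → ℝ := fun t => ‖h T‖ + ε / 2 * (Real.exp (a * t) - Real.exp (a * T)) with hB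
  have hBd : ∀ t : ℝ, HasDerivAt B (Real.exp (a * t) * (a * ε / 2)) t := by
    intro t
    have h1 : HasDerivAt (fun t : ℝ => Real.exp (a * t)) (Real.exp (a * t) * (a * 1)) t :=
      ((hasDerivAt_id t).const_mul a).exp
    have h2 := ((h1.sub_const (Real.exp (a * T))).const_mul (ε / 2)).const_add (‖h T‖)
    refine h2.congr_deriv ?_
    ring
  have key : ∀ t, T ≤ t → ‖h t‖ ≤ B t := by
    intro t ht
    have hT0' : 0 ≤ T := le_max_right _ _
    refine image_norm_le_of_norm_deriv_right_le_deriv_boundary (a := T) (b := t)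
      (f' := fun t : ℝ => Complex.exp (l * t) * (g t - G))
      (fun s hs => (hd s (hT0'.trans hs.1)).continuousAt.continuousWithinAt)
      (fun s hs => (hd s (hT0'.trans hs.1)).hasDerivWithinAt) (by simp [hB]) hBd ?_ ⟨ht, le_rfl⟩
    intro s hs
    rw [norm_mul, hnorm]
    have := hT0 s ((le_max_left _ _).trans hs.1)
    rw [dist_eq_norm] at this
    gcongr
  have hlim : Tendsto (fun t : ℝ => ‖h T‖ * Real.exp (-(a * t))) atTop (nhds 0) := by
    have : Tendsto (fun t : ℝ => a * t) atTop atTop := tendsto_id.const_mul_atTop hl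
    simpa using (Real.tendsto_exp_neg_atTop_nhds_zero.comp this).const_mul (‖h T‖)
  have hev := hlim.eventually (gt_mem_nhds (half_pos hε))
  obtain ⟨T1, hT1⟩ := eventually_atTop.1 hev
  refine ⟨max T T1, fun t ht => ?_⟩
  have h1 := key t ((le_max_left _ _).trans ht)
  have h2 := hT1 t ((le_max_right _ _).trans ht)
  rw [dist_eq_norm]
  simp only [hB] at h1
  have h3 : ‖h t‖ = Real.exp (a * t) * ‖f t - G / l‖ := by
    simp only [hh, norm_mul, hnorm]
  rw [h3] at h1
  rw [Real.exp_neg, ← div_eq_mul_inv, div_lt_iff₀ (Real.exp_pos _)] at h2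
  have h4 := Real.exp_pos (a * t)
  have h5 := mul_pos (half_pos hε) (Real.exp_pos (a * T))
  refine lt_of_mul_lt_mul_left (a := Real.exp (a * t)) ?_ h4.le
  nlinarith

theorem tri_aux {n : ℕ} (D : Matrix (Fin n) (Fin n) ℂ)
    (hD : ∀ i j : Fin n, j < i → D i j = 0) (hp : ∀ i, 0 < (D i i).re)
    (W w g : ℝ → Fin n → ℂ) (G : Fin n → ℂ)
    (hW : ∀ k t, 0 ≤ t → HasDerivAt (fun t => W t k) (w t k) t)
    (hw : ∀ k t, 0 ≤ t → w t k = g t k - (D *ᵥ W t) k)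
    (hg : ∀ k, Tendsto (fun t => g t k) atTop (nhds (G k))) (k : Fin n) :
    (∃ c, Tendsto (fun t => W t k) atTop (nhds c)) ∧
      Tendsto (fun t => w t k) atTop (nhds 0) := by
  induction k using WellFoundedGT.induction with
  | ind k ih =>
  choose! c hc using fun j hj => (ih j hj).1
  have hsum : ∀ t, (D *ᵥ W t) k = D k k * W t k + ∑ j ∈ Finset.Ioi k, D k j * W t j := by
    intro t
    simp only [Matrix.mulVec, dotProduct]
    rw [← Finset.sum_subset (Finset.subset_univ (Finset.Ici k))]
    · rw [← Finset.Ioi_insert, Finset.sum_insert (by simp)]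
    · intro j _ hj
      rw [hD k j (by simpa using hj), zero_mul]
  have hg' : Tendsto (fun t => g t k - ∑ j ∈ Finset.Ioi k, D k j * W t j) atTop
      (nhds (G k - ∑ j ∈ Finset.Ioi k, D k j * c j)) :=
    (hg k).sub (tendsto_finsetSum _ fun j hj => (hc j (by simpa using hj)).const_mul _)
  have hW' := scalar_aux _ _ (D k k) _ (hp k) (fun t ht => (hW k t ht).congr_deriv
    (by rw [hw k t ht, hsum t]; ring)) hg'
  refine ⟨⟨_, hW'⟩, ?_⟩
  have h0 : D k k ≠ 0 := fun h => by have := hp k; simp [h] at this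
  have := hg'.sub (hW'.const_mul (D k k))
  rw [mul_div_cancel₀ _ h0, sub_self] at this
  refine this.congr' ?_
  filter_upwards [eventually_ge_atTop 0] with t ht
  rw [hw k t ht, hsum t]; ring

theorem pi_consensus_main_lemma {N : ℕ} {L : Matrix (Fin N) (Fin N) ℝ} {ω : Fin N → ℝ}
    {U V : Matrix (Fin N) (Fin (N - 1)) ℂ} {D : Matrix (Fin (N - 1)) (Fin (N - 1)) ℂ}
    (h : LapDecomp N L ω U V D) {ρ : ℝ} (hρ : 0 < ρ) (xbar : Fin N → ℝ)
    (x : ℝ → Fin N → ℝ) (hx : ContinuousOn x (Set.Ici 0))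
    (z : ℝ → Fin N → ℝ)
    (hz : ∀ t : ℝ, 0 ≤ t → z t = x t - xbar + ρ • ∫ s in (0:ℝ)..t, L *ᵥ x s)
    (hzb : ∃ M : ℝ, ∀ t : ℝ, 0 ≤ t → ‖z t‖ ≤ M)
    (hz0 : Tendsto z atTop (nhds 0)) :
    (∀ i j : Fin N, Tendsto (fun t : ℝ => x t i - x t j) atTop (nhds 0)) ∧
    (∀ i : Fin N, Tendsto (fun t : ℝ => x t i) atTop (nhds (∑ j, ω j * xbar j))) := by
  suffices hmain : ∀ i : Fin N, Tendsto (fun t : ℝ => x t i) atTop (nhds (∑ j, ω j * xbar j)) from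
    ⟨fun i j => by simpa using (hmain i).sub (hmain j), hmain⟩
  -- continuous extension
  set y : ℝ → Fin N → ℝ := fun t => x (max t 0) with hy
  have hyc : Continuous y := hx.comp_continuous (by fun_prop) (fun t => Set.mem_Ici.2 (le_max_right _ _))
  have hyx : ∀ t, 0 ≤ t → y t = x t := fun t ht => by simp [hy, ht]
  set X : ℝ → Fin N → ℝ := fun t => ∫ s in (0:ℝ)..t, y s with hX
  have hXd : ∀ t, HasDerivAt X (y t) t := fun t => hyc.integral_hasStrictDerivAt 0 t |>.hasDerivAt
  have hint : ∀ t, 0 ≤ t → ∫ s in (0:ℝ)..t, L *ᵥ x s = L *ᵥ X t := by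
    intro t ht
    have h1 : ∫ s in (0:ℝ)..t, L *ᵥ x s = ∫ s in (0:ℝ)..t, L *ᵥ y s := by
      refine intervalIntegral.integral_congr fun s hs => ?_
      rw [Set.uIcc_of_le ht] at hs
      simp only [hyx s hs.1]
    rw [h1]
    exact (LinearMap.toContinuousLinearMap (Matrix.mulVecLin L)).intervalIntegral_comp_comm
      (hyc.intervalIntegrable 0 t)
  let c : (Fin N → ℝ) → (Fin N → ℂ) := fun v i => (v i : ℂ)
  have hcL : ∀ v, c (L *ᵥ v) = (U * D * Vᵀ) *ᵥ c v := by
    intro v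
    rw [← h.L_eq]
    ext i
    simp [c, Matrix.mulVec, dotProduct]
  have hcz : ∀ t, 0 ≤ t → c (z t) = c (x t) - c xbar + (ρ : ℂ) • ((U * D * Vᵀ) *ᵥ c (X t)) := by
    intro t ht
    rw [hz t ht, hint t ht, ← hcL]
    ext i
    simp [c]
  have hcz0 : ∀ i, Tendsto (fun t => c (z t) i) atTop (nhds 0) := by
    intro i
    have h1 := (tendsto_pi_nhds.1 hz0) i
    have h2 := (Complex.continuous_ofReal.tendsto _).comp h1
    rw [Pi.zero_apply, Complex.ofReal_zero] at h2
    exact h2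
  have hVz0 : ∀ k, Tendsto (fun t => (Vᵀ *ᵥ c (z t)) k) atTop (nhds 0) := by
    intro k
    simp only [Matrix.mulVec, dotProduct]
    simpa using tendsto_finsetSum Finset.univ fun i _ => (hcz0 i).const_mul (Vᵀ k i)
  have hw := fun k => (tri_aux ((ρ : ℂ) • D) (fun i j hij => by simp [h.D_upper i j hij])
    (fun i => by simpa using mul_pos hρ (h.D_diag_pos i))
    (fun t => Vᵀ *ᵥ c (X t)) (fun t => Vᵀ *ᵥ c (x t))
    (fun t => Vᵀ *ᵥ c (z t) + Vᵀ *ᵥ c xbar) (Vᵀ *ᵥ c xbar)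
    (by
      intro k t ht
      simp only [Matrix.mulVec, dotProduct]
      refine HasDerivAt.fun_sum fun i _ => HasDerivAt.const_mul _ ?_
      have := (hasDerivAt_pi.1 (hXd t)) i
      rw [hyx t ht] at this
      exact this.ofReal_comp)
    (by
      intro k t ht
      have : Vᵀ *ᵥ ((U * D * Vᵀ) *ᵥ c (X t)) = D *ᵥ (Vᵀ *ᵥ c (X t)) := by
        rw [Matrix.mulVec_mulVec, Matrix.mulVec_mulVec, ← Matrix.mul_assoc, ← Matrix.mul_assoc,
          h.VtU, Matrix.one_mul]
      rw [hcz t ht, Matrix.mulVec_add, Matrix.mulVec_sub, Matrix.mulVec_smul, this,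
        Matrix.smul_mulVec]
      simp
      ring)
    (fun k => by simpa using (hVz0 k).add_const ((Vᵀ *ᵥ c xbar) k)) k).2
  have hωz : ∀ t, 0 ≤ t → c ω ⬝ᵥ c (x t) = c ω ⬝ᵥ c (z t) + c ω ⬝ᵥ c xbar := by
    intro t ht
    have h1 : c ω ⬝ᵥ ((U * D * Vᵀ) *ᵥ c (X t)) = 0 := by
      have h2 : c ω ᵥ* U = 0 := h.omega_U
      rw [Matrix.dotProduct_mulVec, Matrix.mul_assoc, ← Matrix.vecMul_vecMul, h2]
      simp
    rw [hcz t ht, dotProduct_add, dotProduct_sub, dotProduct_smul, h1]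
    simp
  have hωlim : Tendsto (fun t => c ω ⬝ᵥ c (x t)) atTop (nhds (c ω ⬝ᵥ c xbar)) := by
    have h1 : Tendsto (fun t => c ω ⬝ᵥ c (z t)) atTop (nhds 0) := by
      simp only [dotProduct]
      simpa using tendsto_finsetSum Finset.univ fun i _ => (hcz0 i).const_mul (c ω i)
    have h2 := h1.add_const (c ω ⬝ᵥ c xbar)
    rw [zero_add] at h2
    refine h2.congr' ?_
    filter_upwards [eventually_ge_atTop 0] with t ht
    rw [hωz t ht]
  intro i
  have hdec : ∀ t, (U *ᵥ (Vᵀ *ᵥ c (x t))) i + c ω ⬝ᵥ c (x t) = (x t i : ℂ) := by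
    intro t
    have h1 := congrFun (congrArg (fun M => M *ᵥ c (x t)) h.UVt) i
    simp only [Matrix.add_mulVec, Matrix.one_mulVec, ← Matrix.mulVec_mulVec, Pi.add_apply] at h1
    exact h1
  have hU : Tendsto (fun t => (U *ᵥ (Vᵀ *ᵥ c (x t))) i) atTop (nhds 0) := by
    have := tendsto_finsetSum Finset.univ fun k _ => (hw k).const_mul (U i k)
    simpa [Matrix.mulVec, dotProduct] using this
  have hfin := hU.add hωlim
  simp only [hdec, zero_add] at hfin
  have hre := (Complex.continuous_re.tendsto _).comp hfin
  have hval : (c ω ⬝ᵥ c xbar).re = ∑ j, ω j * xbar j := by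
    simp [c, dotProduct]
  rw [hval] at hre
  exact hre
end
end

section
/- (Corollary of the Main Lemma / Remark 1.) Suppose the N×N real matrix L satisfies the Laplacian decomposition hypotheses with data (ω, U, V, D). Let ρ > 0, let x : [0,∞) → ℝ^N be continuous, and define z(t) := x(t) − x(0) + ρ ∫₀ᵗ L x(s) ds (i.e. the PI consensus error with fixed points x̄_i = x_i(0)). If z is bounded on [0,∞) and lim_{t→∞} z(t) = 0, then every component x_i(t) converges as t → ∞ to the weighted average Σ_{j=1}^N ω_j x_j(0) of the initial conditions. -/
open Matrix Filter
open scoped Matrix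

noncomputable section

lemma aux_scalar_s9 (a : ℂ) (ha : 0 < a.re) (q f : ℝ → ℂ)
    (hq : ∀ t, 0 ≤ t → HasDerivAt q (-a * q t + f t) t)
    (hf : Tendsto f atTop (nhds 0)) : Tendsto q atTop (nhds 0) := by
  rw [Metric.tendsto_atTop] at hf ⊢
  intro ε hε
  obtain ⟨T0, hT0⟩ := hf (ε / 2 * a.re) (by positivity)
  set T := max T0 0 with hT
  have hTT : T0 ≤ T := le_max_left _ _
  have hT0' : 0 ≤ T := le_max_right _ _
  have hnexp : ∀ t : ℝ, ‖Complex.exp (a * t)‖ = Real.exp (a.re * t) := by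
    intro t; rw [Complex.norm_exp]; simp
  have hd : ∀ t : ℝ, 0 ≤ t → HasDerivAt (fun s : ℝ => Complex.exp (a * s) * q s)
      (Complex.exp (a * t) * f t) t := by
    intro t ht
    have h1 : HasDerivAt (fun s : ℝ => a * (s : ℂ)) a t := by
      simpa using (Complex.ofRealCLM.hasDerivAt (x := t)).const_mul a
    refine (h1.cexp.mul (hq t ht)).congr_deriv ?_
    ring
  have key : ∀ t : ℝ, T ≤ t → ‖Complex.exp (a * t) * q t‖ ≤
      Real.exp (a.re * T) * ‖q T‖ + ε / 2 * (Real.exp (a.re * t) - Real.exp (a.re * T)) := by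
    intro t ht
    refine image_norm_le_of_norm_deriv_right_le_deriv_boundary (a := T) (b := t)
      (f := fun s : ℝ => Complex.exp (a * s) * q s) (f' := fun s : ℝ => Complex.exp (a * s) * f s)
      (B := fun s => Real.exp (a.re * T) * ‖q T‖ + ε / 2 * (Real.exp (a.re * s) - Real.exp (a.re * T)))
      (B' := fun s => ε / 2 * (Real.exp (a.re * s) * a.re)) ?_ ?_ ?_ ?_ ?_ ⟨ht, le_rfl⟩
    · intro s hs
      exact (hd s (hT0'.trans hs.1)).continuousAt.continuousWithinAt
    · intro s hs
      exact (hd s (hT0'.trans hs.1)).hasDerivWithinAt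
    · simp only [norm_mul, hnexp]; simp
    · intro s
      have h1 : HasDerivAt (fun s : ℝ => a.re * s) a.re s := by
        simpa using (hasDerivAt_id s).const_mul a.re
      exact ((h1.exp.sub_const _).const_mul (ε / 2)).const_add _
    · intro s hs
      have := (hT0 s (hTT.trans hs.1)).le
      rw [dist_zero_right] at this
      rw [norm_mul, hnexp]
      have hp := Real.exp_pos (a.re * s)
      nlinarith
  have hlim : Tendsto (fun t : ℝ => Real.exp (a.re * T) * ‖q T‖ * Real.exp (-(a.re * t)))
      atTop (nhds 0) := by
    have : Tendsto (fun t : ℝ => Real.exp (-(a.re * t))) atTop (nhds 0) :=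
      Real.tendsto_exp_neg_atTop_nhds_zero.comp (tendsto_id.const_mul_atTop ha)
    simpa using this.const_mul (Real.exp (a.re * T) * ‖q T‖)
  obtain ⟨T1, hT1⟩ := (Metric.tendsto_atTop.1 hlim) (ε / 2) (by positivity)
  refine ⟨max T T1, fun t ht => ?_⟩
  have k := key t ((le_max_left _ _).trans ht)
  have l := hT1 t ((le_max_right _ _).trans ht)
  rw [dist_zero_right] at l ⊢
  have l := (le_abs_self _).trans_lt l
  rw [norm_mul, hnexp] at k
  rw [Real.exp_neg, ← div_eq_mul_inv, div_lt_iff₀ (Real.exp_pos _)] at l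
  have hp := Real.exp_pos (a.re * t)
  have hp' := Real.exp_pos (a.re * T)
  by_contra hc
  push Not at hc
  nlinarith

/-- complexified multiplication by the transpose. -/
def auxK {N M : ℕ} (V : Matrix (Fin N) (Fin M) ℂ) : (Fin N → ℝ) →ₗ[ℝ] (Fin M → ℂ) where
  toFun v := Vᵀ *ᵥ (fun i => (v i : ℂ))
  map_add' v w := by
    rw [← Matrix.mulVec_add]; congr 1; ext i; simp
  map_smul' c v := by
    ext j
    simp only [Matrix.mulVec, dotProduct, Pi.smul_apply, smul_eq_mul, Complex.ofReal_mul,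
      RingHom.id_apply, Finset.smul_sum, Complex.real_smul]
    exact Finset.sum_congr rfl fun i _ => by ring

/-- Corollary of the Main Lemma (Remark 1): choosing the fixed points `x̄_i = x_i(0)` in the PI
consensus error `z t := x t − x 0 + ρ ∫₀ᵗ L x s ds`, if `z` is bounded on `[0,∞)` and `z t → 0`,
then every component `x_i t` converges to the weighted average `Σ_j ω_j x_j(0)` of the initial
conditions. -/
theorem pi_consensus_initial_average {N : ℕ} {L : Matrix (Fin N) (Fin N) ℝ} {ω : Fin N → ℝ}
    {U V : Matrix (Fin N) (Fin (N - 1)) ℂ} {D : Matrix (Fin (N - 1)) (Fin (N - 1)) ℂ}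
    (h : LapDecomp N L ω U V D) {ρ : ℝ} (hρ : 0 < ρ)
    (x : ℝ → Fin N → ℝ) (hx : ContinuousOn x (Set.Ici 0))
    (z : ℝ → Fin N → ℝ)
    (hz : ∀ t : ℝ, 0 ≤ t → z t = x t - x 0 + ρ • ∫ s in (0:ℝ)..t, L *ᵥ x s)
    (hzb : ∃ M : ℝ, ∀ t : ℝ, 0 ≤ t → ‖z t‖ ≤ M)
    (hz0 : Tendsto z atTop (nhds 0)) :
    ∀ i : Fin N, Tendsto (fun t : ℝ => x t i) atTop (nhds (∑ j, ω j * x 0 j)) := by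
  classical
  set K := auxK V with hK
  have hcL : ∀ v : Fin N → ℝ, (fun i => ((L *ᵥ v) i : ℂ)) =
      (U * D * Vᵀ) *ᵥ (fun i => (v i : ℂ)) := by
    intro v
    rw [← h.L_eq]; ext i
    simp [Matrix.mulVec, dotProduct]
  have hKL : ∀ v, K (L *ᵥ v) = D *ᵥ K v := by
    intro v
    change Vᵀ *ᵥ (fun i => ((L *ᵥ v) i : ℂ)) = D *ᵥ (Vᵀ *ᵥ (fun i => (v i : ℂ)))
    rw [hcL, Matrix.mulVec_mulVec, Matrix.mulVec_mulVec, ← Matrix.mul_assoc, ← Matrix.mul_assoc,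
      h.VtU, Matrix.one_mul]
  have hωL : ∀ v : Fin N → ℝ, ω ⬝ᵥ (L *ᵥ v) = 0 := by
    intro v
    have : (fun i => (ω i : ℂ)) ⬝ᵥ (fun i => ((L *ᵥ v) i : ℂ)) = 0 := by
      rw [hcL, Matrix.dotProduct_mulVec, ← Matrix.vecMul_vecMul, ← Matrix.vecMul_vecMul, h.omega_U]
      simp
    have h2 : ((ω ⬝ᵥ (L *ᵥ v) : ℝ) : ℂ) = 0 := by
      rw [← this]; simp [dotProduct]
    exact_mod_cast h2
  -- continuous extension
  set X : ℝ → Fin N → ℝ := fun t => x (max t 0) with hX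
  have hXc : Continuous X := hx.comp_continuous (by fun_prop)
    (fun t => Set.mem_Ici.2 (le_max_right t 0))
  have hXx : ∀ t, 0 ≤ t → X t = x t := fun t ht => by simp [hX, ht]
  set P : ℝ → Fin N → ℝ := fun t => ∫ s in (0:ℝ)..t, X s with hP
  have hPd : ∀ t, HasDerivAt P (X t) t := fun t =>
    intervalIntegral.integral_hasDerivAt_right (hXc.intervalIntegrable _ _)
      (hXc.stronglyMeasurableAtFilter _ _) hXc.continuousAt
  have hzP : ∀ t, 0 ≤ t → z t = x t - x 0 + ρ • (L *ᵥ P t) := by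
    intro t ht
    rw [hz t ht]
    congr 2
    have e1 : ∫ s in (0:ℝ)..t, L *ᵥ x s = ∫ s in (0:ℝ)..t, L *ᵥ X s := by
      apply intervalIntegral.integral_congr
      intro s hs
      rw [Set.uIcc_of_le ht] at hs
      simp only [hXx s hs.1]
    rw [e1]
    exact (Matrix.mulVecLin L).toContinuousLinearMap.intervalIntegral_comp_comm
      (hXc.intervalIntegrable 0 t)
  set q : ℝ → Fin (N - 1) → ℂ := fun t => K (x 0) - ρ • (D *ᵥ K (P t)) with hq
  have hqe : ∀ t, 0 ≤ t → K (X t) = q t + K (z t) := by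
    intro t ht
    rw [hzP t ht, hXx t ht, map_add, map_sub, map_smul, hKL]
    simp only [hq]; abel
  have hKc : Continuous K := K.continuous_of_finiteDimensional
  have hKz : Tendsto (fun t => K (z t)) atTop (nhds 0) := by
    have := (hKc.tendsto 0).comp hz0
    rwa [map_zero] at this
  have hqd : ∀ t j, HasDerivAt (fun t => q t j) (-(ρ • (D *ᵥ K (X t)) j)) t := by
    intro t j
    have h1 : HasDerivAt (fun t => K (P t)) (K (X t)) t :=
      (K.toContinuousLinearMap.hasFDerivAt.comp_hasDerivAt t (hPd t))
    have h2 : HasDerivAt (fun t => (D *ᵥ K (P t)) j) ((D *ᵥ K (X t)) j) t := by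
      simp only [Matrix.mulVec, dotProduct]
      refine HasDerivAt.fun_sum fun k _ => ?_
      exact ((hasDerivAt_pi.1 h1) k).const_mul _
    exact (h2.const_smul ρ).const_sub _
  have hqK : ∀ j, Tendsto (fun t => q t j) atTop (nhds 0) →
      Tendsto (fun t => K (X t) j) atTop (nhds 0) := by
    intro j hj
    have := hj.add ((tendsto_pi_nhds.1 hKz) j)
    simp only [Pi.zero_apply, add_zero] at this
    refine this.congr' ?_
    filter_upwards [eventually_ge_atTop 0] with t ht
    rw [hqe t ht]; rfl
  have hy : ∀ j, Tendsto (fun t => K (X t) j) atTop (nhds 0) := by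
    intro j
    induction j using WellFoundedGT.induction with
    | ind j ih =>
    apply hqK
    refine aux_scalar_s9 (ρ * D j j) (by simpa using mul_pos hρ (h.D_diag_pos j)) _
      (fun t => -(ρ * (D j j * K (z t) j + ∑ k ∈ Finset.univ.erase j, D j k * K (X t) k))) ?_ ?_
    · intro t ht
      convert hqd t j using 1
      have e : (D *ᵥ K (X t)) j = D j j * K (X t) j
          + ∑ k ∈ Finset.univ.erase j, D j k * K (X t) k := by
        rw [Finset.add_sum_erase _ (fun k => D j k * K (X t) k) (Finset.mem_univ j)]; rfl
      have e2 : K (X t) j = q t j + K (z t) j := by rw [hqe t ht]; rfl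
      rw [e, Complex.real_smul]
      rw [e2]; ring
    · have t1 : Tendsto (fun t => D j j * K (z t) j) atTop (nhds 0) := by
        simpa using ((tendsto_pi_nhds.1 hKz) j).const_mul (D j j)
      have t2 : Tendsto (fun t => ∑ k ∈ Finset.univ.erase j, D j k * K (X t) k) atTop (nhds 0) := by
        rw [show (0:ℂ) = ∑ k ∈ Finset.univ.erase j, 0 by simp]
        refine tendsto_finsetSum _ fun k hk => ?_
        rcases lt_or_gt_of_ne (Finset.ne_of_mem_erase hk) with hlt | hgt
        · simp [h.D_upper j k hlt]
        · simpa using (ih k hgt).const_mul (D j k)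
      simpa using ((t1.add t2).const_mul (ρ : ℂ)).neg
  have hw : Tendsto (fun t => ω ⬝ᵥ X t) atTop (nhds (ω ⬝ᵥ x 0)) := by
    have h1 : Tendsto (fun t => ω ⬝ᵥ z t) atTop (nhds 0) := by
      have hc : Continuous (fun v : Fin N → ℝ => ω ⬝ᵥ v) := by
        unfold dotProduct; fun_prop
      have := (hc.tendsto 0).comp hz0
      rwa [dotProduct_zero] at this
    have h2 := h1.add_const (ω ⬝ᵥ x 0)
    rw [zero_add] at h2
    refine h2.congr' ?_
    filter_upwards [eventually_ge_atTop 0] with t ht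
    rw [hzP t ht, hXx t ht, dotProduct_add, dotProduct_sub, dotProduct_smul, hωL]
    simp
  intro i
  have hrec : ∀ t, (X t i : ℂ) = (∑ k, U i k * K (X t) k) + ((ω ⬝ᵥ X t : ℝ) : ℂ) := by
    intro t
    have h1 : (1 : Matrix (Fin N) (Fin N) ℂ) *ᵥ (fun i => (X t i : ℂ)) = fun i => (X t i : ℂ) :=
      Matrix.one_mulVec _
    rw [← h.UVt, Matrix.add_mulVec, ← Matrix.mulVec_mulVec] at h1
    have h2 := congrFun h1 i
    simp only [Pi.add_apply] at h2
    rw [← h2]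
    congr 1
    simp [Matrix.mulVec, dotProduct]
  have hfin : Tendsto (fun t => (X t i : ℂ)) atTop (nhds ((ω ⬝ᵥ x 0 : ℝ) : ℂ)) := by
    simp_rw [hrec]
    have t2 : Tendsto (fun t => ∑ k, U i k * K (X t) k) atTop (nhds 0) := by
      rw [show (0:ℂ) = ∑ k : Fin (N - 1), 0 by simp]
      refine tendsto_finsetSum _ fun k hk => ?_
      simpa using (hy k).const_mul (U i k)
    simpa using t2.add ((Complex.continuous_ofReal.tendsto _).comp hw)
  have hre := (Complex.continuous_re.tendsto _).comp hfin
  refine Tendsto.congr' ?_ hre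
  filter_upwards [eventually_ge_atTop 0] with t ht
  simp [hXx t ht]
end
end

section
/- (Nussbaum boundedness lemma.) Let 0 < t_f ≤ ∞, let V : [0,t_f) → ℝ and k : [0,t_f) → ℝ be continuously differentiable with V(t) ≥ 0 for all t ∈ [0,t_f), let N : ℝ → ℝ be an even smooth Nussbaum-type function, and let θ₀ be a nonzero real constant. If V(t) ≤ ∫₀ᵗ (θ₀ N(k(τ)) + 1) k'(τ) dτ + c for all t ∈ [0,t_f), where c ∈ ℝ is a constant, then V(t), k(t), and ∫₀ᵗ (θ₀ N(k(τ)) + 1) k'(τ) dτ are all bounded on [0,t_f). -/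
open Filter

noncomputable section

/-- `f` is a Nussbaum-type function: `limsup_{k→∞} (1/k)∫₀ᵏ f = +∞` and
`liminf_{k→∞} (1/k)∫₀ᵏ f = −∞`, expressed via frequent exceedance of every bound. -/
def IsNussbaum (f : ℝ → ℝ) : Prop :=
  (∀ M : ℝ, ∃ᶠ k in atTop, M < (1 / k) * ∫ τ in (0:ℝ)..k, f τ) ∧
  (∀ M : ℝ, ∃ᶠ k in atTop, (1 / k) * ∫ τ in (0:ℝ)..k, f τ < M)

theorem freq_aux (f : ℝ → ℝ) (hf : IsNussbaum f) (θ : ℝ) (hθ : θ ≠ 0) (A B : ℝ) :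
    (∃ x, B < x ∧ 1 ≤ x ∧ θ * (∫ τ in (0:ℝ)..x, f τ) < -A * x) ∧
    (∃ x, B < x ∧ 1 ≤ x ∧ A * x < θ * (∫ τ in (0:ℝ)..x, f τ)) := by
  obtain ⟨h1, h2⟩ := hf
  have hev : ∀ᶠ x : ℝ in atTop, B < x ∧ 1 ≤ x :=
    (eventually_gt_atTop B).and (eventually_ge_atTop 1)
  have up : ∀ M : ℝ, ∃ x, B < x ∧ 1 ≤ x ∧ M * x < ∫ τ in (0:ℝ)..x, f τ := by
    intro M
    obtain ⟨x, hx, hB, h1x⟩ := ((h1 M).and_eventually hev).exists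
    refine ⟨x, hB, h1x, ?_⟩
    have hx0 : 0 < x := by linarith
    rwa [one_div_mul_eq_div, lt_div_iff₀ hx0] at hx
  have dn : ∀ M : ℝ, ∃ x, B < x ∧ 1 ≤ x ∧ (∫ τ in (0:ℝ)..x, f τ) < M * x := by
    intro M
    obtain ⟨x, hx, hB, h1x⟩ := ((h2 M).and_eventually hev).exists
    refine ⟨x, hB, h1x, ?_⟩
    have hx0 : 0 < x := by linarith
    rwa [one_div_mul_eq_div, div_lt_iff₀ hx0] at hx
  have e1 : ∀ x, θ * (A / θ * x) = A * x := by intro x; field_simp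
  have e2 : ∀ x, θ * (-A / θ * x) = -A * x := by intro x; field_simp
  rcases lt_or_gt_of_ne hθ with h | h
  · obtain ⟨x, a, b, hx⟩ := up (-A / θ)
    obtain ⟨y, a', b', hy⟩ := dn (A / θ)
    refine ⟨⟨x, a, b, ?_⟩, ⟨y, a', b', ?_⟩⟩
    · rw [← e2]; exact mul_lt_mul_of_neg_left hx h
    · rw [← e1]; exact mul_lt_mul_of_neg_left hy h
  · obtain ⟨x, a, b, hx⟩ := dn (-A / θ)
    obtain ⟨y, a', b', hy⟩ := up (A / θ)
    refine ⟨⟨x, a, b, ?_⟩, ⟨y, a', b', ?_⟩⟩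
    · rw [← e2]; exact mul_lt_mul_of_pos_left hx h
    · rw [← e1]; exact mul_lt_mul_of_pos_left hy h

/-- Nussbaum boundedness lemma: if `V ≥ 0` and `k` are continuously differentiable on `[0, t_f)`
(`0 < t_f ≤ ∞`), `Nf` is an even smooth Nussbaum-type function, `θ₀ ≠ 0`, and
`V t ≤ ∫₀ᵗ (θ₀ Nf (k τ) + 1) k' τ dτ + c` on `[0, t_f)`, then `V`, `k` and
`t ↦ ∫₀ᵗ (θ₀ Nf (k τ) + 1) k' τ dτ` are bounded on `[0, t_f)`. -/
theorem nussbaum_boundedness (tf : EReal) (htf : 0 < tf)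
    (V k V' k' : ℝ → ℝ)
    (hV : ∀ t : ℝ, 0 ≤ t → (t : EReal) < tf → HasDerivAt V (V' t) t)
    (hk : ∀ t : ℝ, 0 ≤ t → (t : EReal) < tf → HasDerivAt k (k' t) t)
    (hV'c : ContinuousOn V' {t : ℝ | 0 ≤ t ∧ (t : EReal) < tf})
    (hk'c : ContinuousOn k' {t : ℝ | 0 ≤ t ∧ (t : EReal) < tf})
    (hVnonneg : ∀ t : ℝ, 0 ≤ t → (t : EReal) < tf → 0 ≤ V t)
    (Nf : ℝ → ℝ) (hNeven : ∀ s : ℝ, Nf (-s) = Nf s) (hNsmooth : ContDiff ℝ (⊤ : ℕ∞) Nf)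
    (hNuss : IsNussbaum Nf)
    (θ₀ : ℝ) (hθ₀ : θ₀ ≠ 0) (c : ℝ)
    (hineq : ∀ t : ℝ, 0 ≤ t → (t : EReal) < tf →
      V t ≤ (∫ τ in (0:ℝ)..t, (θ₀ * Nf (k τ) + 1) * k' τ) + c) :
    ∃ M : ℝ, ∀ t : ℝ, 0 ≤ t → (t : EReal) < tf →
      |V t| ≤ M ∧ |k t| ≤ M ∧ |∫ τ in (0:ℝ)..t, (θ₀ * Nf (k τ) + 1) * k' τ| ≤ M := by
  have hNc : Continuous Nf := hNsmooth.continuous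
  set F : ℝ → ℝ := fun x => ∫ τ in (0:ℝ)..x, Nf τ with hF
  have hFd : ∀ x, HasDerivAt F (Nf x) x := fun x =>
    intervalIntegral.integral_hasDerivAt_right (hNc.intervalIntegrable _ _)
      (hNc.stronglyMeasurableAtFilter _ _) hNc.continuousAt
  have hFodd : ∀ x, F (-x) = - F x := by
    intro x
    have h := intervalIntegral.integral_comp_neg (a := 0) (b := x) Nf
    simp only [hNeven, neg_zero] at h
    simp only [hF]
    rw [h, intervalIntegral.integral_symm]
  set G : ℝ → ℝ := fun x => θ₀ * F x + x with hG
  have hGd : ∀ x, HasDerivAt G (θ₀ * Nf x + 1) x := fun x =>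
    ((hFd x).const_mul θ₀).add (hasDerivAt_id x)
  have hGc : Continuous G := continuous_iff_continuousAt.2 fun x => (hGd x).continuousAt
  have hsub : ∀ t : ℝ, (t : EReal) < tf → ∀ s : ℝ, s ≤ t → (s : EReal) < tf := fun t ht s hs =>
    lt_of_le_of_lt (EReal.coe_le_coe_iff.2 hs) ht
  have hkc : ∀ t : ℝ, (t : EReal) < tf → ContinuousOn k (Set.Icc 0 t) := fun t ht s hs =>
    (hk s hs.1 (hsub t ht s hs.2)).continuousAt.continuousWithinAt
  have hint : ∀ t : ℝ, 0 ≤ t → (t : EReal) < tf →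
      (∫ τ in (0:ℝ)..t, (θ₀ * Nf (k τ) + 1) * k' τ) = G (k t) - G (k 0) := by
    intro t h0 ht
    have := intervalIntegral.integral_eq_sub_of_hasDerivAt (a := 0) (b := t)
      (f := fun s => G (k s)) (f' := fun τ => (θ₀ * Nf (k τ) + 1) * k' τ) ?_ ?_
    · exact this
    · intro s hs
      rw [Set.uIcc_of_le h0] at hs
      exact (hGd (k s)).comp s (hk s hs.1 (hsub t ht s hs.2))
    · apply ContinuousOn.intervalIntegrable
      rw [Set.uIcc_of_le h0]
      refine ContinuousOn.mul ?_ (hk'c.mono fun s hs => ⟨hs.1, hsub t ht s hs.2⟩)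
      exact (continuousOn_const.mul (hNc.comp_continuousOn (hkc t ht))).add continuousOn_const
  set L := G (k 0) - c with hL
  have hlow : ∀ t : ℝ, 0 ≤ t → (t : EReal) < tf → L ≤ G (k t) := by
    intro t h0 ht
    have h1 := hineq t h0 ht
    have h2 := hVnonneg t h0 ht
    rw [hint t h0 ht] at h1
    linarith
  obtain ⟨⟨x, hxB, hx1, hx⟩, ⟨y, hyB, hy1, hy⟩⟩ :=
    freq_aux Nf hNuss θ₀ hθ₀ (1 + |L|) |k 0|
  have hLabs := neg_abs_le L
  have hLnn := abs_nonneg L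
  have hGx : G x < L := by
    change θ₀ * F x < _ at hx
    change θ₀ * F x + x < L
    nlinarith
  have hGy : G (-y) < L := by
    change _ < θ₀ * F y at hy
    change θ₀ * F (-y) + -y < L
    rw [hFodd]
    nlinarith
  have hk0 := abs_lt.1 hxB
  have hk0' := abs_lt.1 hyB
  have hkb : ∀ t : ℝ, 0 ≤ t → (t : EReal) < tf → k t ∈ Set.Icc (-y) x := by
    intro t h0 ht
    constructor
    · by_contra! hlt
      obtain ⟨s, hs, hse⟩ := intermediate_value_Icc' h0 (hkc t ht) ⟨hlt.le, hk0'.1.le⟩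
      have := hlow s hs.1 (hsub t ht s hs.2)
      rw [hse] at this
      linarith
    · by_contra! hlt
      obtain ⟨s, hs, hse⟩ := intermediate_value_Icc h0 (hkc t ht) ⟨hk0.2.le, hlt.le⟩
      have := hlow s hs.1 (hsub t ht s hs.2)
      rw [hse] at this
      linarith
  obtain ⟨C, hC⟩ := (isCompact_Icc (a := -y) (b := x)).exists_bound_of_continuousOn
    hGc.continuousOn
  refine ⟨C + |G (k 0)| + |c| + x + y, ?_⟩
  intro t h0 ht
  have hkt := hkb t h0 ht
  have hCt := hC _ hkt
  rw [Real.norm_eq_abs] at hCt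
  have hC0 : 0 ≤ C := (abs_nonneg _).trans hCt
  have hi := hineq t h0 ht
  rw [hint t h0 ht] at hi ⊢
  have hv := hVnonneg t h0 ht
  have a1 := abs_le.1 hCt
  have a2 := neg_abs_le (G (k 0))
  have a3 := le_abs_self (G (k 0))
  have a4 := le_abs_self c
  have a5 := abs_nonneg c
  have a6 := abs_nonneg (G (k 0))
  obtain ⟨b1, b2⟩ := hkt
  refine ⟨?_, ?_, ?_⟩ <;> rw [abs_le] <;> constructor <;> linarith [a1.1, a1.2]
end
end

section
/- (Theorem 1: adaptive consensus of first-order agents with unknown non-identical control directions.) Let N ≥ 2 agents have scalar dynamics ẋ_i = b_i u_i + θ_i^T φ_i(x_i), i = 1,...,N, where each b_i ∈ ℝ is nonzero, θ_i ∈ ℝ^{ℓ_i}, and φ_i : ℝ → ℝ^{ℓ_i} is smooth. Let a_{ij} ≥ 0 be adjacency weights with a_{ii} = 0, let L be the associated graph Laplacian (L_{ii} = Σ_{j≠i} a_{ij}, L_{ij} = −a_{ij} for j ≠ i), and assume L satisfies the Laplacian decomposition hypotheses with data (ω, U, V, D). Fix ρ, ν > 0, γ_i > 0, x̄ ∈ ℝ^N,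 let N(ζ) := ζ² cos(ζ), and define z_i(t) := x_i(t) − x̄_i + ρ ∫₀ᵗ Σ_j a_{ij}(x_i(s) − x_j(s)) ds. Suppose x_i : [0,∞) → ℝ, θ̂_i : [0,∞) → ℝ^{ℓ_i}, ζ_i : [0,∞) → ℝ are continuously differentiable and satisfy for all t ≥ 0 the closed-loop equations ẋ_i = b_i u_i + θ_i^T φ_i(x_i), u_i = N(ζ_i)[θ̂_i^T φ_i(x_i) + ρ Σ_j a_{ij}(x_i − x_j) + ν z_i], θ̂'_i = γ_i φ_i(x_i) z_i, and ζ'_i = ν z_i² + z_i [θ̂_i^T φ_i(x_i) + ρ Σ_j a_{ij}(x_i − x_j)]. Then all signals x_i, z_i, θ̂_i, ζ_i, u_i are bounded on [0,∞), lim_{t→∞}(x_i(t) − x_j(t)) = 0 for all i, j, and lim_{t→∞} x_i(t) = Σ_{j=1}^N ω_j x̄_j for every i. -/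
open Matrix Filter
open scoped Matrix

noncomputable section

def Bd {E : Type*} [NormedAddCommGroup E] (f : ℝ → E) : Prop := ∃ M : ℝ, ∀ t : ℝ, 0 ≤ t → ‖f t‖ ≤ M

lemma Bd.const {E : Type*} [NormedAddCommGroup E] (c : E) : Bd (fun _ => c) := ⟨‖c‖, fun _ _ => le_rfl⟩

lemma Bd.add {E : Type*} [NormedAddCommGroup E] {f g : ℝ → E} (hf : Bd f) (hg : Bd g) :
    Bd (fun t => f t + g t) := by
  obtain ⟨A, hA⟩ := hf
  obtain ⟨B, hB⟩ := hg
  exact ⟨A + B, fun t ht => (norm_add_le _ _).trans (add_le_add (hA t ht) (hB t ht))⟩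

lemma Bd.sub {E : Type*} [NormedAddCommGroup E] {f g : ℝ → E} (hf : Bd f) (hg : Bd g) :
    Bd (fun t => f t - g t) := by
  obtain ⟨A, hA⟩ := hf
  obtain ⟨B, hB⟩ := hg
  exact ⟨A + B, fun t ht => (norm_sub_le _ _).trans (add_le_add (hA t ht) (hB t ht))⟩

lemma Bd.mul {E : Type*} [NormedRing E] {f g : ℝ → E} (hf : Bd f) (hg : Bd g) :
    Bd (fun t => f t * g t) := by
  obtain ⟨A, hA⟩ := hf
  obtain ⟨B, hB⟩ := hg
  exact ⟨A * B, fun t ht => (norm_mul_le _ _).trans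
    (mul_le_mul (hA t ht) (hB t ht) (norm_nonneg _) ((norm_nonneg _).trans (hA t ht)))⟩

lemma Bd.sum {E ι : Type*} [NormedAddCommGroup E] (s : Finset ι) {f : ι → ℝ → E}
    (hf : ∀ i ∈ s, Bd (f i)) : Bd (fun t => ∑ i ∈ s, f i t) := by
  classical
  choose! M hM using hf
  exact ⟨∑ i ∈ s, M i, fun t ht => norm_sum_le_of_le _ fun i hi => hM i hi t ht⟩

lemma Bd.comp {E F : Type*} [NormedAddCommGroup E] [ProperSpace E] [NormedAddCommGroup F]
    {f : ℝ → E} (hf : Bd f) {g : E → F} (hg : Continuous g) : Bd (fun t => g (f t)) := by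
  obtain ⟨A, hA⟩ := hf
  obtain ⟨C, hC⟩ := (isCompact_closedBall (0 : E) A).exists_bound_of_continuousOn hg.continuousOn
  exact ⟨C, fun t ht => hC _ (by simpa using hA t ht)⟩

lemma Bd.congr {E : Type*} [NormedAddCommGroup E] {f g : ℝ → E} (hf : Bd f)
    (h : ∀ t, 0 ≤ t → g t = f t) : Bd g := by
  obtain ⟨A, hA⟩ := hf
  exact ⟨A, fun t ht => by rw [h t ht]; exact hA t ht⟩

lemma scalar_est (h : ℝ → ℂ) (f : ℝ → ℂ) (l : ℂ) (hl : 0 < l.re)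
    (hd : ∀ t : ℝ, 0 ≤ t → HasDerivAt h (f t - l * h t) t)
    (T ε : ℝ) (hT : 0 ≤ T) (hf : ∀ t, T ≤ t → ‖f t‖ ≤ ε) (t : ℝ) (ht : T ≤ t) :
    ‖h t‖ ^ 2 ≤ ε ^ 2 / l.re ^ 2 + Real.exp (-l.re * (t - T)) * ‖h T‖ ^ 2 := by
  set c := l.re with hc
  have hy : ∀ t, 0 ≤ t → HasDerivAt (fun t => ‖h t‖ ^ 2) (2 * ((h t).re * (f t - l * h t).re + (h t).im * (f t - l * h t).im)) t := by
    intro t ht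
    have := (hd t ht).norm_sq
    convert this using 1
    simp only [Complex.inner, Complex.mul_re, Complex.conj_re, Complex.conj_im]
    ring
  have hy2 : ∀ t, 0 ≤ t → HasDerivAt (fun t => Real.exp (c * (t - T)) * (‖h t‖ ^ 2 - ε ^ 2 / c ^ 2))
     (Real.exp (c * (t - T)) * c * (‖h t‖ ^ 2 - ε ^ 2 / c ^ 2) + Real.exp (c * (t - T)) * (2 * ((h t).re * (f t - l * h t).re + (h t).im * (f t - l * h t).im))) t := by
    intro t ht
    have h1 : HasDerivAt (fun t : ℝ => Real.exp (c * (t - T))) (Real.exp (c * (t - T)) * c) t := by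
      have := (((hasDerivAt_id t).sub_const T).const_mul c).exp
      simpa using this
    exact h1.mul ((hy t ht).sub_const _)
  have hanti : AntitoneOn (fun t => Real.exp (c * (t - T)) * (‖h t‖ ^ 2 - ε ^ 2 / c ^ 2)) (Set.Ici T) := by
    apply antitoneOn_of_hasDerivWithinAt_nonpos (convex_Ici T)
      (fun t ht => (hy2 t (hT.trans ht)).continuousAt.continuousWithinAt)
      (fun t ht => (hy2 t (hT.trans (interior_subset ht))).hasDerivWithinAt)
    intro t ht
    have ht' : T ≤ t := interior_subset ht
    have e := Real.exp_pos (c * (t - T))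
    have hf2 : (f t).re ^ 2 + (f t).im ^ 2 ≤ ε ^ 2 := by
      have h1 := hf t ht'
      have h2 : ‖f t‖ ^ 2 = (f t).re ^ 2 + (f t).im ^ 2 := by
        rw [← Complex.normSq_eq_norm_sq, Complex.normSq_apply]; ring
      rw [← h2]; gcongr
    have h2 : ‖h t‖ ^ 2 = (h t).re ^ 2 + (h t).im ^ 2 := by
        rw [← Complex.normSq_eq_norm_sq, Complex.normSq_apply]; ring
    have key : c * (‖h t‖ ^ 2 - ε ^ 2 / c ^ 2) + (2 * ((h t).re * (f t - l * h t).re + (h t).im * (f t - l * h t).im)) ≤ 0 := by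
      have e1 : c * (ε ^ 2 / c ^ 2) = ε ^ 2 / c := by field_simp
      have e2 : ((f t).re ^ 2 + (f t).im ^ 2) / c ≤ ε ^ 2 / c := by gcongr
      have e3 : 0 ≤ ((f t).re - c * (h t).re) ^ 2 / c + ((f t).im - c * (h t).im) ^ 2 / c := by positivity
      have e4 : ((f t).re - c * (h t).re) ^ 2 / c + ((f t).im - c * (h t).im) ^ 2 / c
        = ((f t).re ^ 2 + (f t).im ^ 2) / c - 2 * ((h t).re * (f t).re + (h t).im * (f t).im) + c * ((h t).re ^ 2 + (h t).im ^ 2) := by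
        field_simp; ring
      rw [mul_sub, e1, h2]
      simp only [Complex.sub_re, Complex.sub_im, Complex.mul_re, Complex.mul_im, ← hc]
      nlinarith
    nlinarith
  have := hanti (Set.self_mem_Ici) (show t ∈ Set.Ici T from ht) ht
  simp only [sub_self, mul_zero, Real.exp_zero, one_mul] at this
  have e1 : Real.exp (-c * (t - T)) * Real.exp (c * (t - T)) = 1 := by
    rw [← Real.exp_add]; simp
  have e2 := mul_le_mul_of_nonneg_left this (Real.exp_pos (-c * (t - T))).le
  rw [← mul_assoc, e1] at e2
  have e3 : 0 ≤ Real.exp (-c * (t - T)) * (ε ^ 2 / c ^ 2) := by positivity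
  nlinarith

lemma scalar_bd (h : ℝ → ℂ) (f : ℝ → ℂ) (l : ℂ) (hl : 0 < l.re)
    (hd : ∀ t : ℝ, 0 ≤ t → HasDerivAt h (f t - l * h t) t) (hf : Bd f) : Bd h := by
  obtain ⟨ε, hε⟩ := hf
  refine ⟨Real.sqrt (ε ^ 2 / l.re ^ 2 + ‖h 0‖ ^ 2), fun t ht => Real.le_sqrt_of_sq_le ?_⟩
  refine (scalar_est h f l hl hd 0 ε le_rfl hε t ht).trans ?_
  have : Real.exp (-l.re * (t - 0)) ≤ 1 := by
    rw [Real.exp_le_one_iff]; nlinarith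
  gcongr
  exact mul_le_of_le_one_left (by positivity) this

lemma scalar_tendsto (h : ℝ → ℂ) (f : ℝ → ℂ) (l : ℂ) (hl : 0 < l.re)
    (hd : ∀ t : ℝ, 0 ≤ t → HasDerivAt h (f t - l * h t) t) (hf : Tendsto f atTop (nhds 0)) :
    Tendsto h atTop (nhds 0) := by
  rw [Metric.tendsto_atTop]
  intro δ hδ
  obtain ⟨T0, hT0⟩ := Metric.tendsto_atTop.1 hf (l.re * δ / 2) (by positivity)
  set T := max T0 0 with hT
  have h1 : Tendsto (fun t : ℝ => Real.exp (-l.re * (t - T)) * ‖h T‖ ^ 2) atTop (nhds 0) := by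
    have : Tendsto (fun t : ℝ => l.re * (t - T)) atTop atTop :=
      (tendsto_atTop_add_const_right _ (-T) tendsto_id).const_mul_atTop hl
    have := (Real.tendsto_exp_neg_atTop_nhds_zero.comp this).mul_const (‖h T‖ ^ 2)
    simpa [Function.comp_def] using this
  obtain ⟨S, hS⟩ := (h1.eventually_lt_const (show (0:ℝ) < δ ^ 2 / 2 by positivity)).exists_forall_of_atTop
  refine ⟨max S T, fun t ht => ?_⟩
  have h2 := scalar_est h f l hl hd T (l.re * δ / 2) (le_max_right _ _)
    (fun t ht => by simpa using (hT0 t ((le_max_left _ _).trans ht)).le) t ((le_max_right _ _).trans ht)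
  have h3 := hS t ((le_max_left _ _).trans ht)
  have h4 : (l.re * δ / 2) ^ 2 / l.re ^ 2 = δ ^ 2 / 4 := by field_simp; norm_num
  rw [dist_zero_right]
  apply lt_of_pow_lt_pow_left₀ 2 hδ.le
  have : 0 < δ ^ 2 := by positivity
  linarith

lemma tri_deriv {n : ℕ} (D : Matrix (Fin n) (Fin n) ℂ) (hD : ∀ i j, j < i → D i j = 0)
    (ρ : ℝ) (h v : Fin n → ℝ → ℂ)
    (hd : ∀ k t, 0 ≤ t → HasDerivAt (h k) (∑ m, ρ * D k m * (v m t - h m t)) t) (k : Fin n) (t : ℝ) (ht : 0 ≤ t) :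
    HasDerivAt (h k) ((∑ m, ρ * D k m * v m t - ∑ m ∈ Finset.univ.filter (fun m => k < m), ρ * D k m * h m t) -
      (ρ * D k k) * h k t) t := by
  convert hd k t ht using 1
  simp only [mul_sub, Finset.sum_sub_distrib]
  rw [sub_sub]
  congr 1
  rw [← Finset.sum_filter_add_sum_filter_not Finset.univ (fun m => k < m)]
  congr 1
  symm
  apply Finset.sum_eq_single_of_mem
  · simp
  · intro m hm hmk
    rw [hD k m]
    · simp
    · simp at hm; exact lt_of_le_of_ne hm hmk

lemma tri_bd {n : ℕ} (D : Matrix (Fin n) (Fin n) ℂ) (hD : ∀ i j, j < i → D i j = 0)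
    (hpos : ∀ i, 0 < (D i i).re)
    (ρ : ℝ) (hρ : 0 < ρ) (h v : Fin n → ℝ → ℂ)
    (hd : ∀ k t, 0 ≤ t → HasDerivAt (h k) (∑ m, ρ * D k m * (v m t - h m t)) t)
    (hv : ∀ k, Bd (v k)) (k : Fin n) : Bd (h k) := by
  induction k using WellFoundedGT.induction with
  | ind k ih =>
  refine scalar_bd _ _ _ ?_ (tri_deriv D hD ρ h v hd k) ?_
  · simpa using mul_pos hρ (hpos k)
  · exact (Bd.sum _ fun m _ => (Bd.const _).mul (hv m)).sub
      (Bd.sum _ fun m hm => (Bd.const _).mul (ih m (by simpa using hm)))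

lemma tri_tendsto {n : ℕ} (D : Matrix (Fin n) (Fin n) ℂ) (hD : ∀ i j, j < i → D i j = 0)
    (hpos : ∀ i, 0 < (D i i).re)
    (ρ : ℝ) (hρ : 0 < ρ) (h v : Fin n → ℝ → ℂ)
    (hd : ∀ k t, 0 ≤ t → HasDerivAt (h k) (∑ m, ρ * D k m * (v m t - h m t)) t)
    (hv : ∀ k, Tendsto (v k) atTop (nhds 0)) (k : Fin n) : Tendsto (h k) atTop (nhds 0) := by
  induction k using WellFoundedGT.induction with
  | ind k ih =>
  refine scalar_tendsto _ _ _ ?_ (tri_deriv D hD ρ h v hd k) ?_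
  · simpa using mul_pos hρ (hpos k)
  · have h1 : Tendsto (fun t => ∑ m, ρ * D k m * v m t) atTop (nhds (∑ m, ρ * D k m * 0)) :=
      tendsto_finsetSum _ fun m _ => (hv m).const_mul _
    have h2 : Tendsto (fun t => ∑ m ∈ Finset.univ.filter (fun m => k < m), ρ * D k m * h m t) atTop
        (nhds (∑ m ∈ Finset.univ.filter (fun m => k < m), ρ * D k m * 0)) :=
      tendsto_finsetSum _ fun m hm => (ih m (by simpa using hm)).const_mul _
    simpa using h1.sub h2

/-- Barbalat-type lemma. -/
lemma barbalat (W w w' : ℝ → ℝ) (hW : ∀ t, 0 ≤ t → HasDerivAt W (w t) t)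
    (hw : ∀ t, 0 ≤ t → HasDerivAt w (w' t) t) (hw0 : ∀ t, 0 ≤ t → 0 ≤ w t)
    (hWb : Bd W) (hb : Bd w') : Tendsto w atTop (nhds 0) := by
  obtain ⟨B, hB⟩ := hWb
  obtain ⟨M0, hM0⟩ := hb
  obtain ⟨M, hMpos, hM⟩ : ∃ M : ℝ, 0 < M ∧ ∀ t, 0 ≤ t → ‖w' t‖ ≤ M :=
    ⟨max M0 1, by positivity, fun t ht => (hM0 t ht).trans (le_max_left _ _)⟩
  have hmono : MonotoneOn W (Set.Ici 0) :=
    monotoneOn_of_hasDerivWithinAt_nonneg (convex_Ici 0)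
      (fun t ht => (hW t ht).continuousAt.continuousWithinAt)
      (fun t ht => (hW t (interior_subset ht)).hasDerivWithinAt)
      (fun t ht => hw0 t (interior_subset ht))
  have hlim : ∃ l, Tendsto W atTop (nhds l) := by
    have hm : Monotone (fun t => W (max t 0)) := fun s t hst =>
      hmono (by simp) (by simp) (max_le_max_right _ hst)
    have hbd : BddAbove (Set.range (fun t => W (max t 0))) := by
      refine ⟨B, ?_⟩
      rintro _ ⟨t, rfl⟩
      exact (le_abs_self _).trans (hB _ (by simp))
    refine ⟨_, (tendsto_atTop_ciSup hm hbd).congr' ?_⟩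
    filter_upwards [eventually_ge_atTop (0:ℝ)] with t ht
    simp [ht]
  obtain ⟨l, hl⟩ := hlim
  rw [Metric.tendsto_atTop]
  intro ε hε
  set d := ε / (2 * M) with hd
  have hdpos : 0 < d := by positivity
  have h1 : Tendsto (fun t => W (t + d) - W t) atTop (nhds 0) := by
    have := (hl.comp (tendsto_atTop_add_const_right _ d tendsto_id)).sub hl
    simpa using this
  obtain ⟨S, hS⟩ := (h1.eventually_lt_const (show (0:ℝ) < d * (ε / 2) by positivity)).exists_forall_of_atTop
  refine ⟨max S 0, fun t ht => ?_⟩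
  have ht0 : 0 ≤ t := (le_max_right _ _).trans ht
  have h2 := hS t ((le_max_left _ _).trans ht)
  obtain ⟨c, hc, hcd⟩ := exists_hasDerivAt_eq_slope W w (show t < t + d by linarith)
    (fun s hs => (hW s (ht0.trans hs.1)).continuousAt.continuousWithinAt)
    (fun s hs => hW s (ht0.trans hs.1.le))
  have h3 : w c < ε / 2 := by
    rw [hcd, add_sub_cancel_left, div_lt_iff₀ hdpos]; linarith
  have h4 := (convex_Ici (0:ℝ)).norm_image_sub_le_of_norm_hasDerivWithin_le (f := w) (f' := w')
    (fun s hs => (hw s hs).hasDerivWithinAt) (fun s hs => hM s hs)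
    (show t ∈ Set.Ici (0:ℝ) from ht0) (show c ∈ Set.Ici (0:ℝ) from ht0.trans hc.1.le)
  rw [Real.norm_eq_abs, Real.norm_eq_abs, abs_of_pos (by linarith [hc.1] : 0 < c - t)] at h4
  have h5 : M * (c - t) ≤ ε / 2 := by
    have : c - t ≤ d := by linarith [hc.2]
    calc M * (c - t) ≤ M * d := by gcongr
      _ = ε / 2 := by rw [hd]; field_simp
  have h6 := neg_abs_le (w c - w t)
  rw [dist_zero_right, Real.norm_eq_abs, abs_of_nonneg (hw0 t ht0)]
  linarith

lemma nuss_pt (b : ℝ) (hb : b ≠ 0) (C R : ℝ) :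
    ∃ p, R < p ∧ 0 < p ∧ b * (p ^ 2 * Real.sin p + 2 * p * Real.cos p - 2 * Real.sin p) + p < C := by
  have hev : ∀ᶠ p : ℝ in atTop, R < p ∧ 0 < p ∧ -|b| * (p ^ 2 - 2) + p < C := by
    refine (eventually_gt_atTop R).and ((eventually_gt_atTop 0).and ?_)
    have hb' := abs_pos.2 hb
    filter_upwards [eventually_gt_atTop (2 / |b|), eventually_gt_atTop (2 * |b| - C), eventually_gt_atTop 0] with p h1 h2 h3
    rw [div_lt_iff₀ hb'] at h1
    nlinarith
  obtain ⟨P, hP⟩ := hev.exists_forall_of_atTop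
  obtain ⟨k, hk⟩ := exists_nat_gt P
  have hpi := Real.pi_gt_three
  rcases lt_or_gt_of_ne hb with h | h
  · have h1 := hP (Real.pi / 2 + k * (2 * Real.pi)) (by nlinarith [k.cast_nonneg (α := ℝ)])
    refine ⟨_, h1.1, h1.2.1, ?_⟩
    have h2 := h1.2.2
    rw [Real.sin_add_nat_mul_two_pi, Real.cos_add_nat_mul_two_pi, Real.sin_pi_div_two, Real.cos_pi_div_two]
    rw [abs_of_neg h] at h2
    linarith
  · have h1 := hP (-(Real.pi / 2) + (k + 1 : ℕ) * (2 * Real.pi)) (by push_cast; nlinarith [k.cast_nonneg (α := ℝ)])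
    refine ⟨_, h1.1, h1.2.1, ?_⟩
    have h2 := h1.2.2
    rw [Real.sin_add_nat_mul_two_pi, Real.cos_add_nat_mul_two_pi, Real.sin_neg, Real.cos_neg, Real.sin_pi_div_two, Real.cos_pi_div_two]
    rw [abs_of_pos h] at h2
    linarith

lemma nuss_bd (b : ℝ) (hb : b ≠ 0) (C : ℝ) (ζ : ℝ → ℝ) (hζ : Continuous ζ)
    (h : ∀ t, 0 ≤ t → C ≤ b * (ζ t ^ 2 * Real.sin (ζ t) + 2 * ζ t * Real.cos (ζ t) - 2 * Real.sin (ζ t)) + ζ t) :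
    Bd ζ := by
  obtain ⟨p, hp1, hp0, hp⟩ := nuss_pt b hb C (ζ 0)
  obtain ⟨q, hq1, hq0, hq⟩ := nuss_pt (-b) (neg_ne_zero.2 hb) C (-ζ 0)
  refine ⟨max p q, fun t ht => ?_⟩
  rw [Real.norm_eq_abs, abs_le]
  constructor
  · by_contra! hlt
    have : -q ∈ Set.Icc (ζ t) (ζ 0) := ⟨by linarith [le_max_right p q], by linarith⟩
    obtain ⟨s, hs, hs'⟩ := intermediate_value_Icc' ht hζ.continuousOn this
    have := h s hs.1
    rw [hs', Real.sin_neg, Real.cos_neg] at this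
    nlinarith
  · by_contra! hlt
    have : p ∈ Set.Icc (ζ 0) (ζ t) := ⟨by linarith, by linarith [le_max_left p q]⟩
    obtain ⟨s, hs, hs'⟩ := intermediate_value_Icc ht hζ.continuousOn this
    have := h s hs.1
    rw [hs'] at this
    linarith

/-- Single agent analysis. -/
lemma agent {n : ℕ} (b : ℝ) (hb : b ≠ 0) (θ : Fin n → ℝ) (ν : ℝ) (hν : 0 < ν) (γ : ℝ) (hγ : 0 < γ)
    (z ζ ξ : ℝ → ℝ) (ψ θh : ℝ → Fin n → ℝ) (hζc : Continuous ζ)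
    (hz : ∀ t : ℝ, 0 ≤ t → HasDerivAt z (b * (ζ t ^ 2 * Real.cos (ζ t) *
        (∑ p, θh t p * ψ t p + ξ t + ν * z t)) + ∑ p, θ p * ψ t p + ξ t) t)
    (hadapt : ∀ t : ℝ, 0 ≤ t → HasDerivAt θh (fun p => γ * ψ t p * z t) t)
    (hnuss : ∀ t : ℝ, 0 ≤ t → HasDerivAt ζ (ν * (z t) ^ 2 +
        z t * (∑ p, θh t p * ψ t p + ξ t)) t) :
    Bd z ∧ Bd ζ ∧ Bd θh ∧ ∃ W : ℝ → ℝ, Bd W ∧ ∀ t, 0 ≤ t → HasDerivAt W (ν * z t ^ 2) t := by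
  set G : ℝ → ℝ := fun s => b * (s ^ 2 * Real.sin s + 2 * s * Real.cos s - 2 * Real.sin s) + s with hG
  have hGd : ∀ s, HasDerivAt G (b * (s ^ 2 * Real.cos s) + 1) s := by
    intro s
    have h1 := ((hasDerivAt_id s).pow 2).mul (Real.hasDerivAt_sin s)
    have h2 := ((hasDerivAt_id s).const_mul 2).mul (Real.hasDerivAt_cos s)
    have h3 := (Real.hasDerivAt_sin s).const_mul 2
    have := (((h1.add h2).sub h3).const_mul b).add (hasDerivAt_id s)
    refine HasDerivAt.congr_deriv this ?_
    simp only [id, Pi.pow_apply]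
    push_cast
    ring
  have hGc : Continuous G := by fun_prop
  set Vf : ℝ → ℝ := fun t => z t ^ 2 / 2 + (∑ p, (θ p - θh t p) ^ 2) / (2 * γ) with hV
  have hV0 : ∀ t, 0 ≤ Vf t := fun t => by positivity
  have hVd : ∀ t, 0 ≤ t → HasDerivAt Vf (z t * (b * (ζ t ^ 2 * Real.cos (ζ t) *
        (∑ p, θh t p * ψ t p + ξ t + ν * z t)) + ∑ p, θ p * ψ t p + ξ t) -
        z t * (∑ p, θ p * ψ t p - ∑ p, θh t p * ψ t p)) t := by
    intro t ht
    have h1 := ((hz t ht).pow 2).div_const 2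
    have h2 : ∀ p, HasDerivAt (fun t => (θ p - θh t p) ^ 2) (-(2 * γ) * (z t * (θ p * ψ t p - θh t p * ψ t p))) t := by
      intro p
      have := (((hasDerivAt_pi.1 (hadapt t ht)) p).const_sub (θ p)).pow 2
      refine HasDerivAt.congr_deriv this ?_
      simp
      ring
    have h3 := (HasDerivAt.fun_sum (u := Finset.univ) fun p _ => h2 p).div_const (2 * γ)
    refine HasDerivAt.congr_deriv (h1.add h3) ?_
    rw [← Finset.mul_sum, ← Finset.mul_sum, Finset.sum_sub_distrib]
    field_simp
    ring
  set W : ℝ → ℝ := fun t => G (ζ t) - Vf t with hW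
  have hWd : ∀ t, 0 ≤ t → HasDerivAt W (ν * z t ^ 2) t := by
    intro t ht
    have := ((hGd (ζ t)).comp t (hnuss t ht)).sub (hVd t ht)
    refine HasDerivAt.congr_deriv this ?_
    ring
  have hmono : MonotoneOn W (Set.Ici 0) :=
    monotoneOn_of_hasDerivWithinAt_nonneg (convex_Ici 0)
      (fun t ht => (hWd t ht).continuousAt.continuousWithinAt)
      (fun t ht => (hWd t (interior_subset ht)).hasDerivWithinAt)
      (fun t ht => by positivity)
  have hW0 : ∀ t, 0 ≤ t → W 0 ≤ G (ζ t) - Vf t := fun t ht => hmono Set.self_mem_Ici ht ht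
  have hζb : Bd ζ := nuss_bd b hb (W 0) ζ hζc fun t ht => by
    have := hW0 t ht
    have := hV0 t
    change W 0 ≤ G (ζ t)
    linarith
  have hGb : Bd (fun t => G (ζ t)) := hζb.comp hGc
  have hVb : Bd Vf := by
    obtain ⟨B, hB⟩ := hGb
    refine ⟨B - W 0, fun t ht => ?_⟩
    rw [Real.norm_eq_abs, abs_of_nonneg (hV0 t)]
    have := hW0 t ht
    have := (le_abs_self _).trans (hB t ht)
    linarith
  have hWb : Bd W := hGb.sub hVb
  have hWb' := hWb
  obtain ⟨B, hB⟩ := hVb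
  have hB' : ∀ t, 0 ≤ t → Vf t ≤ B := fun t ht => (le_abs_self _).trans (hB t ht)
  refine ⟨⟨Real.sqrt (2 * B), fun t ht => Real.abs_le_sqrt ?_⟩, hζb, ?_, W, hWb, hWd⟩
  · have := hB' t ht
    have h2 : 0 ≤ (∑ p, (θ p - θh t p) ^ 2) / (2 * γ) := by positivity
    simp only [hV] at this
    linarith
  · have h1 : Bd (fun t => fun p => θ p - θh t p) := by
      refine ⟨Real.sqrt (2 * γ * B), fun t ht => ?_⟩
      rw [pi_norm_le_iff_of_nonneg (Real.sqrt_nonneg _)]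
      intro p
      apply Real.abs_le_sqrt
      have := hB' t ht
      have h2 : 0 ≤ z t ^ 2 / 2 := by positivity
      have h3 : (∑ p, (θ p - θh t p) ^ 2) / (2 * γ) ≤ B := by
        simp only [hV] at this; linarith
      rw [div_le_iff₀ (by positivity)] at h3
      have h4 := Finset.single_le_sum (f := fun p => (θ p - θh t p) ^ 2) (fun p _ => by positivity) (Finset.mem_univ p)
      linarith
    refine ((Bd.const θ).sub h1).congr fun t ht => ?_
    ext p; simp

/-- Theorem 1: adaptive consensus of `N ≥ 2` first-order nonlinear agents
`ẋ_i = b_i u_i + θ_iᵀ φ_i(x_i)` with unknown, non-identical control directions, under the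
Nussbaum-gain distributed controller with PI consensus error variables
`z_i t = x_i t − x̄_i + ρ ∫₀ᵗ Σ_j a_{ij} (x_i − x_j)`.  All closed-loop signals are bounded,
agents reach consensus, and every state converges to `Σ_j ω_j x̄_j`. -/
theorem adaptive_consensus_first_order {N : ℕ} (ℓ : Fin N → ℕ)
    (b : Fin N → ℝ) (hb : ∀ i, b i ≠ 0)
    (θ : (i : Fin N) → Fin (ℓ i) → ℝ)
    (φ : (i : Fin N) → ℝ → Fin (ℓ i) → ℝ) (hφ : ∀ i, ContDiff ℝ (⊤ : ℕ∞) (φ i))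
    (a : Fin N → Fin N → ℝ) (ha : ∀ i j, 0 ≤ a i j) (hadiag : ∀ i, a i i = 0)
    (L : Matrix (Fin N) (Fin N) ℝ)
    (hLdef : ∀ i j, L i j = if i = j then ∑ p, a i p else -(a i j))
    (ω : Fin N → ℝ) (U V : Matrix (Fin N) (Fin (N - 1)) ℂ)
    (D : Matrix (Fin (N - 1)) (Fin (N - 1)) ℂ)
    (hLap : LapDecomp N L ω U V D)
    {ρ ν : ℝ} (hρ : 0 < ρ) (hν : 0 < ν)
    (γ : Fin N → ℝ) (hγ : ∀ i, 0 < γ i)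
    (xbar : Fin N → ℝ)
    (x : Fin N → ℝ → ℝ) (θh : (i : Fin N) → ℝ → Fin (ℓ i) → ℝ)
    (ζ : Fin N → ℝ → ℝ) (u : Fin N → ℝ → ℝ)
    (z : Fin N → ℝ → ℝ)
    (hzdef : ∀ i, ∀ t : ℝ, z i t =
      x i t - xbar i + ρ * ∫ s in (0:ℝ)..t, ∑ j, a i j * (x i s - x j s))
    (hxc : ∀ i, Continuous (x i)) (hθhc : ∀ i, Continuous (θh i))
    (hζc : ∀ i, Continuous (ζ i))
    (hdyn : ∀ i, ∀ t : ℝ, 0 ≤ t →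
      HasDerivAt (x i) (b i * u i t + ∑ p, θ i p * φ i (x i t) p) t)
    (hctrl : ∀ i, ∀ t : ℝ, 0 ≤ t → u i t =
      (ζ i t) ^ 2 * Real.cos (ζ i t) *
        (∑ p, θh i t p * φ i (x i t) p + ρ * ∑ j, a i j * (x i t - x j t) + ν * z i t))
    (hadapt : ∀ i, ∀ t : ℝ, 0 ≤ t →
      HasDerivAt (θh i) (fun p => γ i * φ i (x i t) p * z i t) t)
    (hnuss : ∀ i, ∀ t : ℝ, 0 ≤ t →
      HasDerivAt (ζ i) (ν * (z i t) ^ 2 +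
        z i t * (∑ p, θh i t p * φ i (x i t) p + ρ * ∑ j, a i j * (x i t - x j t))) t) :
    (∃ M : ℝ, ∀ i, ∀ t : ℝ, 0 ≤ t →
      |x i t| ≤ M ∧ |z i t| ≤ M ∧ ‖θh i t‖ ≤ M ∧ |ζ i t| ≤ M ∧ |u i t| ≤ M) ∧
    (∀ i j : Fin N, Tendsto (fun t : ℝ => x i t - x j t) atTop (nhds 0)) ∧
    (∀ i : Fin N, Tendsto (fun t : ℝ => x i t) atTop (nhds (∑ j, ω j * xbar j))) := by
  obtain ⟨hN, hωpos, hωsum, hDup, hDpos, hLeq, hVtU, hVt1, hωU, hUVt⟩ := hLap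
  -- derivative of z - x
  have hLx : ∀ i t, ∑ j, a i j * (x i t - x j t) = ∑ j, L i j * x j t := by
    intro i t
    have h1 : ∀ j, L i j * x j t = (if i = j then (∑ p, a i p) * x j t else 0) - a i j * x j t := by
      intro j
      rw [hLdef]
      split_ifs with h
      · subst h; simp [hadiag]
      · ring
    simp only [h1, Finset.sum_sub_distrib, mul_sub]
    simp [Finset.sum_mul]
  have hq : ∀ i t, HasDerivAt (fun t => z i t - x i t) (ρ * ∑ j, a i j * (x i t - x j t)) t := by
    intro i t
    have hc : Continuous (fun s => ∑ j, a i j * (x i s - x j s)) :=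
      continuous_finsetSum _ fun j _ => continuous_const.mul ((hxc i).sub (hxc j))
    have h1 := (((hc.integral_hasStrictDerivAt 0 t).hasDerivAt).const_mul ρ).sub_const (xbar i)
    refine h1.congr_of_eventuallyEq (Filter.Eventually.of_forall fun s => ?_)
    simp only [hzdef i s]
    ring
  have hzd : ∀ i t, 0 ≤ t → HasDerivAt (z i) (b i * (ζ i t ^ 2 * Real.cos (ζ i t) *
        (∑ p, θh i t p * φ i (x i t) p + ρ * ∑ j, a i j * (x i t - x j t) + ν * z i t)) +
        ∑ p, θ i p * φ i (x i t) p + ρ * ∑ j, a i j * (x i t - x j t)) t := by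
    intro i t ht
    have h1 := (hdyn i t ht).add (hq i t)
    rw [hctrl i t ht] at h1
    refine h1.congr_of_eventuallyEq (Filter.Eventually.of_forall fun s => ?_)
    simp
  have hag := fun i => agent (b i) (hb i) (θ i) ν hν (γ i) (hγ i) (z i) (ζ i)
    (fun t => ρ * ∑ j, a i j * (x i t - x j t)) (fun t => φ i (x i t)) (θh i) (hζc i)
    (hzd i) (hadapt i) (hnuss i)
  have hzb := fun i => (hag i).1
  have hζb := fun i => (hag i).2.1
  have hθb := fun i => (hag i).2.2.1
  -- matrix facts
  have hVL : Vᵀ * L.map Complex.ofReal = D * Vᵀ := by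
    rw [hLeq, Matrix.mul_assoc U, ← Matrix.mul_assoc, hVtU, Matrix.one_mul]
  have hωL : (fun i => (ω i : ℂ)) ᵥ* L.map Complex.ofReal = 0 := by
    rw [hLeq, Matrix.mul_assoc U, ← Matrix.vecMul_vecMul, hωU, Matrix.zero_vecMul]
  have hωL' : ∀ j, ∑ i, ω i * L i j = 0 := by
    intro j
    have := congrFun hωL j
    simp only [Matrix.vecMul, dotProduct, Matrix.map_apply, Pi.zero_apply] at this
    exact_mod_cast this
  -- average
  have havg : ∀ t, ∑ i, ω i * x i t = ∑ i, ω i * z i t + ∑ i, ω i * xbar i := by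
    have hd : ∀ t, HasDerivAt (fun t => ∑ i, ω i * (z i t - x i t)) 0 t := by
      intro t
      have := HasDerivAt.fun_sum (u := Finset.univ) fun i _ => (hq i t).const_mul (ω i)
      refine HasDerivAt.congr_deriv this ?_
      simp only [hLx]
      have : ∑ i, ω i * (ρ * ∑ j, L i j * x j t) = ρ * ∑ j, (∑ i, ω i * L i j) * x j t := by
        simp only [Finset.mul_sum, Finset.sum_mul]
        rw [Finset.sum_comm]
        refine Finset.sum_congr rfl fun j _ => Finset.sum_congr rfl fun i _ => by ring
      rw [this]
      simp [hωL']
    intro t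
    have h1 := is_const_of_deriv_eq_zero (fun t => (hd t).differentiableAt) (fun t => (hd t).deriv) t 0
    simp only [hzdef _ 0, intervalIntegral.integral_same, mul_zero, mul_sub, Finset.sum_sub_distrib, mul_add, Finset.sum_add_distrib] at h1
    simp at h1
    linarith
  -- transformed coordinates
  set v : Fin (N - 1) → ℝ → ℂ := fun k t => ∑ i, V i k * (z i t : ℂ) with hv
  set h : Fin (N - 1) → ℝ → ℂ := fun k t => ∑ i, V i k * ((z i t - x i t : ℝ) : ℂ) with hh
  have hvh : ∀ k t, v k t - h k t = ∑ i, V i k * (x i t : ℂ) := by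
    intro k t
    simp only [hv, hh, ← Finset.sum_sub_distrib]
    refine Finset.sum_congr rfl fun i _ => ?_
    push_cast; ring
  have hhd : ∀ k t, 0 ≤ t → HasDerivAt (h k) (∑ m, ρ * D k m * (v m t - h m t)) t := by
    intro k t _
    have := HasDerivAt.fun_sum (u := Finset.univ) fun i _ => ((hq i t).ofReal_comp).const_mul (V i k)
    refine HasDerivAt.congr_deriv this ?_
    simp only [hLx, hvh]
    have h1 := congrFun (congrArg (fun M => M *ᵥ (fun i => (x i t : ℂ))) hVL) k
    simp only [← Matrix.mulVec_mulVec] at h1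
    simp only [Matrix.mulVec, dotProduct, Matrix.map_apply, Matrix.transpose_apply] at h1
    push_cast
    have h2 := congrArg (fun w => (ρ : ℂ) * w) h1
    rw [Finset.mul_sum, Finset.mul_sum] at h2
    simp only [mul_assoc]
    rw [← h2]
    refine Finset.sum_congr rfl fun i _ => by ring
  have hxrep : ∀ i t, (x i t : ℂ) = ∑ k, U i k * (v k t - h k t) +
      ((∑ j, ω j * z j t + ∑ j, ω j * xbar j : ℝ) : ℂ) := by
    intro i t
    rw [← havg]
    have h1 := congrFun (congrArg (fun M => M *ᵥ (fun i => (x i t : ℂ))) hUVt) i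
    simp only [Matrix.add_mulVec, ← Matrix.mulVec_mulVec, Matrix.one_mulVec] at h1
    simp only [Matrix.mulVec, dotProduct, Matrix.of_apply, Matrix.transpose_apply, Pi.add_apply] at h1
    rw [← h1]
    simp only [hvh]
    push_cast
    rfl
  have hcb : ∀ {f : ℝ → ℝ}, Bd f → Bd (fun t => (f t : ℂ)) := fun hf =>
    hf.comp Complex.continuous_ofReal
  have hvb : ∀ k, Bd (v k) := fun k => Bd.sum _ fun i _ => (Bd.const _).mul (hcb (hzb i))
  have hhb := tri_bd D hDup hDpos ρ hρ h v hhd hvb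
  have hxb : ∀ i, Bd (x i) := by
    intro i
    have h1 : Bd (fun t => ∑ k, U i k * (v k t - h k t) +
      ((∑ j, ω j * z j t + ∑ j, ω j * xbar j : ℝ) : ℂ)) :=
      (Bd.sum _ fun k _ => (Bd.const _).mul ((hvb k).sub (hhb k))).add
        (hcb ((Bd.sum _ fun j _ => (Bd.const _).mul (hzb j)).add (Bd.const _)))
    have h2 := (h1.congr fun t _ => hxrep i t).comp Complex.continuous_re
    simpa using h2
  have hφb : ∀ i p, Bd (fun t => φ i (x i t) p) := fun i p =>
    (hxb i).comp (g := fun s => φ i s p) ((continuous_apply p).comp (hφ i).continuous)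
  have hθpb : ∀ i p, Bd (fun t => θh i t p) := fun i p =>
    (hθb i).comp (g := fun w : Fin (ℓ i) → ℝ => w p) (continuous_apply p)
  have hξb : ∀ i, Bd (fun t => ρ * ∑ j, a i j * (x i t - x j t)) := fun i =>
    (Bd.const _).mul (Bd.sum _ fun j _ => (Bd.const _).mul ((hxb i).sub (hxb j)))
  have hub0 : ∀ i, Bd (fun t => (ζ i t) ^ 2 * Real.cos (ζ i t) *
        (∑ p, θh i t p * φ i (x i t) p + ρ * ∑ j, a i j * (x i t - x j t) + ν * z i t)) := fun i =>
    ((hζb i).comp (g := fun s => s ^ 2 * Real.cos s) (by fun_prop)).mul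
      (((Bd.sum _ fun p _ => (hθpb i p).mul (hφb i p)).add (hξb i)).add ((Bd.const _).mul (hzb i)))
  have hub : ∀ i, Bd (u i) := fun i => (hub0 i).congr (hctrl i)
  have hzdb : ∀ i, Bd (fun t => b i * (ζ i t ^ 2 * Real.cos (ζ i t) *
        (∑ p, θh i t p * φ i (x i t) p + ρ * ∑ j, a i j * (x i t - x j t) + ν * z i t)) +
        ∑ p, θ i p * φ i (x i t) p + ρ * ∑ j, a i j * (x i t - x j t)) := fun i =>
    (((Bd.const _).mul (hub0 i)).add (Bd.sum _ fun p _ => (Bd.const _).mul (hφb i p))).add (hξb i)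
  have hz0 : ∀ i, Tendsto (z i) atTop (nhds 0) := by
    intro i
    obtain ⟨W, hWb, hWd⟩ := (hag i).2.2.2
    have h1 := barbalat W (fun t => ν * z i t ^ 2) _ hWd
      (fun t ht => ((hzd i t ht).pow 2).const_mul ν) (fun t _ => by positivity) hWb
      ((Bd.const ν).mul (((Bd.const ((2 : ℕ) : ℝ)).mul ((hzb i).comp (continuous_pow (2 - 1)))).mul (hzdb i)))
    have h2 := (Real.continuous_sqrt.tendsto _).comp (h1.const_mul (ν⁻¹))
    rw [tendsto_zero_iff_abs_tendsto_zero]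
    simp only [mul_zero, Real.sqrt_zero] at h2
    refine h2.congr fun t => ?_
    simp only [Function.comp]
    rw [inv_mul_cancel_left₀ hν.ne', Real.sqrt_sq_eq_abs]
  have hv0 : ∀ k, Tendsto (v k) atTop (nhds 0) := by
    intro k
    have h1 : Tendsto (v k) atTop (nhds (∑ i, V i k * ((0 : ℝ) : ℂ))) :=
      tendsto_finsetSum _ fun i _ => (((Complex.continuous_ofReal.tendsto _).comp (hz0 i))).const_mul _
    simpa using h1
  have hh0 := tri_tendsto D hDup hDpos ρ hρ h v hhd hv0
  have hxlim : ∀ i, Tendsto (fun t => x i t) atTop (nhds (∑ j, ω j * xbar j)) := by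
    intro i
    have h1 : Tendsto (fun t => ∑ j, ω j * z j t + ∑ j, ω j * xbar j) atTop
        (nhds (∑ j, ω j * 0 + ∑ j, ω j * xbar j)) :=
      (tendsto_finsetSum _ fun j _ => (hz0 j).const_mul _).add_const _
    have h2 : Tendsto (fun t => ∑ k, U i k * (v k t - h k t)) atTop (nhds (∑ k, U i k * (0 - 0))) :=
      tendsto_finsetSum _ fun k _ => ((hv0 k).sub (hh0 k)).const_mul _
    have h3 := h2.add ((Complex.continuous_ofReal.tendsto _).comp h1)
    have h4 := (Complex.continuous_re.tendsto _).comp (h3.congr fun t => (hxrep i t).symm)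
    simpa [Function.comp_def] using h4
  refine ⟨?_, ?_, hxlim⟩
  · choose Mx hMx using hxb
    choose Mz hMz using hzb
    choose Mt hMt using hθb
    choose Mζ hMζ using hζb
    choose Mu hMu using hub
    have key : ∀ (M : Fin N → ℝ) (i : Fin N), M i ≤ ∑ j, |M j| := fun M i =>
      (le_abs_self _).trans (Finset.single_le_sum (f := fun j => |M j|) (fun j _ => abs_nonneg _) (Finset.mem_univ i))
    have kp : ∀ (M : Fin N → ℝ), 0 ≤ ∑ j, |M j| := fun M => Finset.sum_nonneg fun j _ => abs_nonneg _
    have p1 := kp Mx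
    have p2 := kp Mz
    have p3 := kp Mt
    have p4 := kp Mζ
    have p5 := kp Mu
    refine ⟨∑ j, |Mx j| + ∑ j, |Mz j| + ∑ j, |Mt j| + ∑ j, |Mζ j| + ∑ j, |Mu j|, fun i t ht => ?_⟩
    refine ⟨(hMx i t ht).trans ?_, (hMz i t ht).trans ?_, (hMt i t ht).trans ?_,
      (hMζ i t ht).trans ?_, (hMu i t ht).trans ?_⟩
    · linarith [key Mx i]
    · linarith [key Mz i]
    · linarith [key Mt i]
    · linarith [key Mζ i]
    · linarith [key Mu i]
  · intro i j
    simpa using (hxlim i).sub (hxlim j)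
end
end
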